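/- arXiv:1711.06132 — 3 statements merged into one kernel-verified Lean document; each statement's English description precedes it below -/
import Mathlib

section
/- Let ℓ be a prime, r ≥ 1, and Π a closed subgroup of GL_r(ℤ_ℓ). Then the Frattini subgroup Φ(Π), i.e. the intersection of all maximal proper open subgroups of Π, is an open subgroup of Π. -/
open Matrix

/-- Reduction modulo `ℓ ^ n` on `GL_r(ℤ_ℓ)`. -/
noncomputable def glRed (l : ℕ) [Fact (Nat.Prime l)] (r n : ℕ) :
    GL (Fin r) ℤ_[l] →* GL (Fin r) (ZMod (l ^ n)) :=
  Matrix.GeneralLinearGroup.map (PadicInt.toZModPow n)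

/-- `Π(n)`: the kernel of reduction modulo `ℓ ^ n` restricted to the closed subgroup `Π`,
viewed as a subgroup of `Π`. -/
noncomputable def levelSubgroup (l : ℕ) [Fact (Nat.Prime l)] (r : ℕ)
    (P : Subgroup (GL (Fin r) ℤ_[l])) (n : ℕ) : Subgroup ↥P :=
  ((glRed l r n).comp P.subtype).ker

/-- A maximal proper open subgroup of a topological group. -/
def IsMaximalOpenSubgroup {G : Type*} [Group G] [TopologicalSpace G] (U : Subgroup G) : Prop :=
  IsOpen (U : Set G) ∧ U ≠ ⊤ ∧ ∀ V : Subgroup G, IsOpen (V : Set G) → U < V → V = ⊤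

/-- The Frattini subgroup of a topological group: the intersection of all maximal proper
open subgroups. -/
def frattiniOpen (G : Type*) [Group G] [TopologicalSpace G] : Subgroup G :=
  sInf {U : Subgroup G | IsMaximalOpenSubgroup U}

/-- The Frattini subgroup of a subgroup `K`, viewed as a subgroup of the ambient group. -/
def frattiniOf {G : Type*} [Group G] [TopologicalSpace G] (K : Subgroup G) : Subgroup G :=
  (frattiniOpen ↥K).map K.subtype

/-- `𝒞_n(Π)`: the set of open subgroups `U ⊆ Π` with `Φ(Π(n-1)) ⊆ U` but `Π(n-1) ⊄ U`. -/
noncomputable def Cn (l : ℕ) [Fact (Nat.Prime l)] (r : ℕ)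
    (P : Subgroup (GL (Fin r) ℤ_[l])) (n : ℕ) : Set (Subgroup ↥P) :=
  {U | IsOpen (U : Set ↥P) ∧ frattiniOf (levelSubgroup l r P (n - 1)) ≤ U ∧
    ¬ levelSubgroup l r P (n - 1) ≤ U}

/-- Congruence subgroup of `P` in explicit form. -/
def congK (l : ℕ) [Fact (Nat.Prime l)] (r : ℕ)
    (P : Subgroup (GL (Fin r) ℤ_[l])) (n : ℕ) : Subgroup ↥P where
  carrier := {g | ∃ A : Matrix (Fin r) (Fin r) ℤ_[l],
    ((g : GL (Fin r) ℤ_[l]) : Matrix (Fin r) (Fin r) ℤ_[l]) = 1 + (l : ℤ_[l]) ^ n • A}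
  mul_mem' := by
    rintro a b ⟨A, hA⟩ ⟨B, hB⟩
    refine ⟨A + B + (l : ℤ_[l]) ^ n • (A * B), ?_⟩
    rw [Subgroup.coe_mul, Units.val_mul, hA, hB]
    simp only [mul_add, add_mul, one_mul, mul_one, smul_add, Matrix.smul_mul, Matrix.mul_smul]
    abel
  one_mem' := ⟨0, by simp⟩
  inv_mem' := by
    rintro a ⟨A, hA⟩
    refine ⟨-(((a : GL (Fin r) ℤ_[l])⁻¹ : GL (Fin r) ℤ_[l]) : Matrix (Fin r) (Fin r) ℤ_[l]) * A, ?_⟩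
    have h := Units.inv_mul (a : GL (Fin r) ℤ_[l])
    rw [Subgroup.coe_inv]
    have h2 : (((a : GL (Fin r) ℤ_[l])⁻¹ : GL (Fin r) ℤ_[l]) : Matrix (Fin r) (Fin r) ℤ_[l])
      * (1 + (l : ℤ_[l]) ^ n • A) = 1 := by rw [← hA]; exact h
    rw [mul_add, mul_one, Matrix.mul_smul] at h2
    rw [neg_mul, smul_neg, ← sub_eq_add_neg]
    exact eq_sub_of_add_eq h2

theorem congK_mem {l : ℕ} [Fact (Nat.Prime l)] {r : ℕ}
    {P : Subgroup (GL (Fin r) ℤ_[l])} {n : ℕ} {g : ↥P} : g ∈ congK l r P n ↔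
    ∃ A : Matrix (Fin r) (Fin r) ℤ_[l],
    ((g : GL (Fin r) ℤ_[l]) : Matrix (Fin r) (Fin r) ℤ_[l]) = 1 + (l : ℤ_[l]) ^ n • A := Iff.rfl

/-- `x⁻¹ * y` lies in the congruence subgroup if the matrices are congruent. -/
theorem congK_of_eq {l : ℕ} [Fact (Nat.Prime l)] {r : ℕ}
    {P : Subgroup (GL (Fin r) ℤ_[l])} {n : ℕ} {x y : ↥P} {C : Matrix (Fin r) (Fin r) ℤ_[l]}
    (h : ((y : GL (Fin r) ℤ_[l]) : Matrix (Fin r) (Fin r) ℤ_[l]) =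
      ((x : GL (Fin r) ℤ_[l]) : Matrix (Fin r) (Fin r) ℤ_[l]) + (l : ℤ_[l]) ^ n • C) :
    x⁻¹ * y ∈ congK l r P n := by
  refine ⟨(((x : GL (Fin r) ℤ_[l])⁻¹ : GL (Fin r) ℤ_[l]) : Matrix (Fin r) (Fin r) ℤ_[l]) * C, ?_⟩
  rw [Subgroup.coe_mul, Units.val_mul, h, Subgroup.coe_inv, mul_add, Units.inv_mul, Matrix.mul_smul]

instance congK_normal (l : ℕ) [Fact (Nat.Prime l)] (r : ℕ)
    (P : Subgroup (GL (Fin r) ℤ_[l])) (n : ℕ) : (congK l r P n).Normal where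
  conj_mem := by
    rintro a ⟨A, hA⟩ g
    refine ⟨((g : GL (Fin r) ℤ_[l]) : Matrix (Fin r) (Fin r) ℤ_[l]) * A *
      (((g : GL (Fin r) ℤ_[l])⁻¹ : GL (Fin r) ℤ_[l]) : Matrix (Fin r) (Fin r) ℤ_[l]), ?_⟩
    rw [Subgroup.coe_mul, Subgroup.coe_mul, Units.val_mul, Units.val_mul, hA, Subgroup.coe_inv,
      mul_add, add_mul, mul_one, Units.mul_inv, Matrix.mul_smul, Matrix.smul_mul]

theorem one_add_pow_expand {R : Type*} [Ring R] (x : R) (k : ℕ) :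
    ∃ c : R, (1 + x) ^ k = 1 + (k : R) * x + x * x * c := by
  induction k with
  | zero => exact ⟨0, by simp⟩
  | succ k ih =>
    obtain ⟨c, hc⟩ := ih
    refine ⟨c + (k : R) + c * x, ?_⟩
    have hk : (k : R) * x = x * k := (Nat.cast_commute k x).eq
    rw [pow_succ, hc]
    push_cast
    have : x * x * (k : R) = k * x * x := by rw [mul_assoc, ← hk, ← mul_assoc, ← hk]
    simp only [mul_add, add_mul, one_mul, mul_one, this]
    simp only [mul_assoc]
    abel

theorem matrix_pow_expand (l : ℕ) [Fact (Nat.Prime l)] (r n : ℕ) (hn : 2 ≤ n)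
    (A : Matrix (Fin r) (Fin r) ℤ_[l]) :
    ∃ B : Matrix (Fin r) (Fin r) ℤ_[l],
      (1 + (l : ℤ_[l]) ^ n • A) ^ l = 1 + (l : ℤ_[l]) ^ (n + 1) • (A + (l : ℤ_[l]) • B) := by
  obtain ⟨c, hc⟩ := one_add_pow_expand ((l : ℤ_[l]) ^ n • A) l
  obtain ⟨m, rfl⟩ := Nat.exists_eq_add_of_le hn
  refine ⟨(l : ℤ_[l]) ^ m • (A * A * c), ?_⟩
  rw [hc]
  have : (l : Matrix (Fin r) (Fin r) ℤ_[l]) = (l : ℤ_[l]) • 1 := by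
    rw [Nat.cast_smul_eq_nsmul, nsmul_eq_mul, mul_one]
  rw [this]
  simp only [Matrix.smul_mul, Matrix.mul_smul, smul_smul, smul_add, one_mul, add_assoc]
  have e1 : (l : ℤ_[l]) ^ (2 + m) * (l : ℤ_[l]) = (l : ℤ_[l]) ^ (2 + (m + 1)) := by ring
  have e2 : (l : ℤ_[l]) ^ (2 + m) * (l : ℤ_[l]) ^ (2 + m) =
      (l : ℤ_[l]) ^ (2 + (m + 1)) * ((l : ℤ_[l]) * (l : ℤ_[l]) ^ m) := by ring
  rw [e1, e2]

/-- The set of leading terms at level `n`, reduced mod `l`. -/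
def leadS (l : ℕ) [Fact (Nat.Prime l)] (r : ℕ)
    (P : Subgroup (GL (Fin r) ℤ_[l])) (n : ℕ) : Set (Matrix (Fin r) (Fin r) (ZMod l)) :=
  {X | ∃ g : ↥P, ∃ A : Matrix (Fin r) (Fin r) ℤ_[l],
    ((g : GL (Fin r) ℤ_[l]) : Matrix (Fin r) (Fin r) ℤ_[l]) = 1 + (l : ℤ_[l]) ^ n • A ∧
    A.map PadicInt.toZMod = X}

theorem map_eq_imp {l : ℕ} [Fact (Nat.Prime l)] {r : ℕ} {A B : Matrix (Fin r) (Fin r) ℤ_[l]}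
    (h : A.map PadicInt.toZMod = B.map PadicInt.toZMod) :
    ∃ C : Matrix (Fin r) (Fin r) ℤ_[l], A = B + (l : ℤ_[l]) • C := by
  have : ∀ i j, ∃ c, A i j = B i j + (l : ℤ_[l]) * c := by
    intro i j
    have hij : PadicInt.toZMod (A i j) = PadicInt.toZMod (B i j) := congrFun (congrFun h i) j
    have : A i j - B i j ∈ RingHom.ker (PadicInt.toZMod (p := l)) := by
      rw [RingHom.mem_ker, map_sub, hij, sub_self]
    rw [PadicInt.ker_toZMod, PadicInt.maximalIdeal_eq_span_p, Ideal.mem_span_singleton] at this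
    obtain ⟨c, hc⟩ := this
    exact ⟨c, by rw [← hc]; ring⟩
  choose C hC using this
  exact ⟨Matrix.of C, by ext i j : 2; simp [hC]⟩

theorem map_add_smul {l : ℕ} [Fact (Nat.Prime l)] {r : ℕ} (B C : Matrix (Fin r) (Fin r) ℤ_[l]) :
    (B + (l : ℤ_[l]) • C).map PadicInt.toZMod = B.map PadicInt.toZMod := by
  ext i j
  simp

theorem leadS_succ {l : ℕ} [Fact (Nat.Prime l)] {r : ℕ}
    (P : Subgroup (GL (Fin r) ℤ_[l])) {n : ℕ} (hn : 2 ≤ n) :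
    leadS l r P n ⊆ leadS l r P (n + 1) := by
  rintro X ⟨g, A, hg, rfl⟩
  obtain ⟨B, hB⟩ := matrix_pow_expand l r n hn A
  refine ⟨g ^ l, A + (l : ℤ_[l]) • B, ?_, map_add_smul A B⟩
  rw [Subgroup.coe_pow, Units.val_pow_eq_pow_val, hg, hB]

theorem exists_stable (l : ℕ) [Fact (Nat.Prime l)] (r : ℕ)
    (P : Subgroup (GL (Fin r) ℤ_[l])) :
    ∃ n0, 2 ≤ n0 ∧ ∀ n, n0 ≤ n → leadS l r P (n + 1) = leadS l r P n := by
  let f : ℕ →o Set (Matrix (Fin r) (Fin r) (ZMod l)) :=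
    ⟨fun n => leadS l r P (n + 2), monotone_nat_of_le_succ fun n => leadS_succ P (by omega)⟩
  obtain ⟨n, hn⟩ := WellFoundedGT.monotone_chain_condition f
  refine ⟨n + 2, by omega, fun m hm => ?_⟩
  obtain ⟨k, rfl⟩ := Nat.exists_eq_add_of_le hm
  have h1 := hn (n + k) (by omega)
  have h2 := hn (n + k + 1) (by omega)
  have h3 : f (n + k + 1) = f (n + k) := by rw [← h1, ← h2]
  have e1 : n + 2 + k + 1 = n + k + 1 + 2 := by omega
  have e2 : n + 2 + k = n + k + 2 := by omega
  rw [e1, e2]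
  exact h3

theorem sup_step {l : ℕ} [Fact (Nat.Prime l)] {r : ℕ}
    {P : Subgroup (GL (Fin r) ℤ_[l])} {n : ℕ} (hn : 2 ≤ n)
    (hS : leadS l r P (n + 1) = leadS l r P n) (U : Subgroup ↥P)
    (hU : U ⊔ congK l r P (n + 1) = ⊤) : U ⊔ congK l r P (n + 2) = ⊤ := by
  rw [eq_top_iff, ← hU]
  refine sup_le le_sup_left ?_
  rintro x ⟨A, hA⟩
  have hX : A.map PadicInt.toZMod ∈ leadS l r P (n + 1) := ⟨x, A, hA, rfl⟩
  rw [hS] at hX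
  obtain ⟨y, A', hy, hAA⟩ := hX
  obtain ⟨D, hD⟩ := map_eq_imp hAA.symm
  have hyt : y ∈ U ⊔ congK l r P (n + 1) := by rw [hU]; trivial
  obtain ⟨u, hu, z, ⟨C, hC⟩, rfl⟩ := Subgroup.mem_sup_of_normal_right.1 hyt
  have hu2 : ((u : GL (Fin r) ℤ_[l]) : Matrix (Fin r) (Fin r) ℤ_[l]) =
      1 + (l : ℤ_[l]) ^ n • (A' - (l : ℤ_[l]) •
        (((u : GL (Fin r) ℤ_[l]) : Matrix (Fin r) (Fin r) ℤ_[l]) * C)) := by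
    rw [Subgroup.coe_mul, Units.val_mul, hC, mul_add, mul_one, Matrix.mul_smul] at hy
    rw [smul_sub, smul_smul, ← pow_succ, ← add_sub_assoc, ← hy]
    abel
  obtain ⟨B, hB⟩ := matrix_pow_expand l r n hn (A' - (l : ℤ_[l]) •
        (((u : GL (Fin r) ℤ_[l]) : Matrix (Fin r) (Fin r) ℤ_[l]) * C))
  rw [← hu2] at hB
  have key : (u ^ l)⁻¹ * x ∈ congK l r P (n + 2) := by
    refine congK_of_eq (C := D + (((u : GL (Fin r) ℤ_[l]) : Matrix (Fin r) (Fin r) ℤ_[l]) * C) - B) ?_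
    rw [Subgroup.coe_pow, Units.val_pow_eq_pow_val, hB, hA, hD]
    rw [show n + 2 = n + 1 + 1 from rfl, pow_succ _ (n + 1), ← smul_smul, add_assoc, ← smul_add]
    congr 2
    simp only [smul_add, smul_sub]
    abel
  have : x = u ^ l * ((u ^ l)⁻¹ * x) := by group
  rw [this]
  exact Subgroup.mul_mem_sup (U.pow_mem hu l) key

theorem congK_isOpen (l : ℕ) [Fact (Nat.Prime l)] (r : ℕ)
    (P : Subgroup (GL (Fin r) ℤ_[l])) (n : ℕ) : IsOpen (congK l r P n : Set ↥P) := by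
  have : (congK l r P n : Set ↥P) = ⋂ i, ⋂ j, {g : ↥P |
      ((g : GL (Fin r) ℤ_[l]) : Matrix (Fin r) (Fin r) ℤ_[l]) i j ∈
        Metric.closedBall ((1 : Matrix (Fin r) (Fin r) ℤ_[l]) i j) ((l : ℝ) ^ (-n : ℤ))} := by
    ext g
    simp only [Set.mem_iInter, Set.mem_ofPred_eq, SetLike.mem_coe, mem_closedBall_iff_norm,
      PadicInt.norm_le_pow_iff_mem_span_pow, Ideal.mem_span_singleton]
    constructor
    · rintro ⟨A, hA⟩ i j
      exact ⟨A i j, by rw [hA]; simp⟩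
    · intro h
      choose A hA using h
      refine ⟨Matrix.of A, ?_⟩
      ext i j : 2
      simp [← hA]
  rw [this]
  refine isOpen_iInter_of_finite fun i => isOpen_iInter_of_finite fun j => ?_
  refine IsOpen.preimage (f := fun g : ↥P =>
    ((g : GL (Fin r) ℤ_[l]) : Matrix (Fin r) (Fin r) ℤ_[l]) i j) ?_
    (IsUltrametricDist.isOpen_closedBall _ ?_)
  · exact (Units.continuous_val.comp continuous_subtype_val).matrix_elem i j
  · have := (Fact.out : Nat.Prime l).pos
    positivity

theorem congK_tendsto {l : ℕ} [Fact (Nat.Prime l)] {r : ℕ}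
    {P : Subgroup (GL (Fin r) ℤ_[l])} (g : ℕ → ↥P) (hg : ∀ n, g n ∈ congK l r P n) :
    Filter.Tendsto (fun n => ((g n : GL (Fin r) ℤ_[l]) : Matrix (Fin r) (Fin r) ℤ_[l]))
      Filter.atTop (nhds 1) := by
  refine tendsto_pi_nhds.2 fun i => tendsto_pi_nhds.2 fun j => ?_
  rw [tendsto_iff_norm_sub_tendsto_zero]
  have hl : (1 : ℝ) < l := by exact_mod_cast (Fact.out : Nat.Prime l).one_lt
  refine squeeze_zero (fun _ => norm_nonneg _) (g := fun n => ((l : ℝ)⁻¹) ^ n) (fun n => ?_)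
    (tendsto_pow_atTop_nhds_zero_of_lt_one (by positivity) (inv_lt_one_of_one_lt₀ hl))
  obtain ⟨A, hA⟩ := hg n
  rw [hA]
  simp only [Matrix.add_apply, Matrix.smul_apply, smul_eq_mul, add_sub_cancel_left, norm_mul,
    norm_pow, PadicInt.norm_p]
  exact mul_le_of_le_one_right (by positivity) (PadicInt.norm_le_one _)

theorem exists_congK_le {l : ℕ} [Fact (Nat.Prime l)] {r : ℕ}
    {P : Subgroup (GL (Fin r) ℤ_[l])} (U : Subgroup ↥P) (hU : IsOpen (U : Set ↥P)) :
    ∃ n, congK l r P n ≤ U := by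
  by_contra! h
  have h' : ∀ n, ∃ g, g ∈ congK l r P n ∧ g ∉ U := fun n => SetLike.not_le_iff_exists.1 (h n)
  choose g hg hgU using h'
  have ht : Filter.Tendsto g Filter.atTop (nhds 1) := by
    rw [Topology.IsInducing.subtypeVal.tendsto_nhds_iff,
      Units.isInducing_embedProduct.tendsto_nhds_iff]
    refine Filter.Tendsto.prodMk_nhds (congK_tendsto g hg) ?_
    exact (MulOpposite.continuous_op.tendsto _).comp
      (congK_tendsto (fun n => (g n)⁻¹) fun n => inv_mem (hg n))
  have := ht.eventually (hU.mem_nhds U.one_mem)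
  obtain ⟨n, hn⟩ := this.exists
  exact hgU n hn

theorem congK_anti {l : ℕ} [Fact (Nat.Prime l)] {r : ℕ}
    {P : Subgroup (GL (Fin r) ℤ_[l])} {m n : ℕ} (h : m ≤ n) :
    congK l r P n ≤ congK l r P m := by
  rintro x ⟨A, hA⟩
  obtain ⟨k, rfl⟩ := Nat.exists_eq_add_of_le h
  exact ⟨(l : ℤ_[l]) ^ k • A, by rw [hA, smul_smul, pow_add]⟩

/-- The Frattini subgroup of a closed subgroup `Π ⊆ GL_r(ℤ_ℓ)` is open in `Π`. -/
theorem frattiniOpen_isOpen (l : ℕ) [Fact (Nat.Prime l)] (r : ℕ)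
    (P : Subgroup (GL (Fin r) ℤ_[l])) (hP : IsClosed (P : Set (GL (Fin r) ℤ_[l]))) :
    IsOpen ((frattiniOpen ↥P : Subgroup ↥P) : Set ↥P) := by
  obtain ⟨n0, h2, hst⟩ := exists_stable l r P
  refine Subgroup.isOpen_mono (H₁ := congK l r P (n0 + 1)) ?_ (congK_isOpen l r P _)
  refine le_sInf ?_
  rintro U ⟨hUo, hUt, hUm⟩
  by_contra hnot
  have hsup : U ⊔ congK l r P (n0 + 1) = ⊤ :=
    hUm _ (Subgroup.isOpen_mono le_sup_left hUo) (left_lt_sup.2 hnot)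
  have hall : ∀ k, U ⊔ congK l r P (n0 + k + 1) = ⊤ := by
    intro k
    induction k with
    | zero => exact hsup
    | succ k ih => exact sup_step (n := n0 + k) (by omega) (hst (n0 + k) (by omega)) U ih
  obtain ⟨k, hk⟩ := exists_congK_le U hUo
  have := hall k
  rw [sup_eq_left.2 ((congK_anti (by omega : k ≤ n0 + k + 1)).trans hk)] at this
  exact hUt this
end

section
/- Let ℓ be a prime and r ≥ 1. Every closed subgroup Π of GL_r(ℤ_ℓ) is topologically finitely generated: there exists a finite subset S of Π such that the closure of the subgroup generated by S equals Π. -/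
open Matrix

section aux
variable {l : ℕ} [Fact (Nat.Prime l)] {r : ℕ}

lemma aux_cong (n : ℕ) (A A' : Matrix (Fin r) (Fin r) ℤ_[l]) :
    A.map (PadicInt.toZModPow n) = A'.map (PadicInt.toZModPow n) ↔
      ∃ B : Matrix (Fin r) (Fin r) ℤ_[l], A = A' + ((l : ℤ_[l]) ^ n) • B := by
  constructor
  · intro h
    have h1 : ∀ i j, ∃ b : ℤ_[l], A i j = A' i j + (l : ℤ_[l]) ^ n * b := by
      intro i j
      have h2 : PadicInt.toZModPow n (A i j) = PadicInt.toZModPow n (A' i j) :=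
        congrFun (congrFun h i) j
      have h3 : A i j - A' i j ∈ RingHom.ker (PadicInt.toZModPow (p := l) n) := by
        rw [RingHom.mem_ker, map_sub, h2, sub_self]
      rw [PadicInt.ker_toZModPow, Ideal.mem_span_singleton] at h3
      obtain ⟨b, hb⟩ := h3
      exact ⟨b, by rw [← hb]; ring⟩
    choose b hb using h1
    refine ⟨Matrix.of b, ?_⟩
    ext i j
    simp [hb i j]
  · rintro ⟨B, rfl⟩
    ext i j
    have h3 : (l : ℤ_[l]) ^ n ∈ RingHom.ker (PadicInt.toZModPow (p := l) n) := by
      rw [PadicInt.ker_toZModPow]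
      exact Ideal.mem_span_singleton_self _
    rw [RingHom.mem_ker] at h3
    simp only [Matrix.map_apply, Matrix.add_apply, Matrix.smul_apply, smul_eq_mul, map_add,
      map_mul, h3, zero_mul, add_zero]

lemma aux_pow {R : Type*} [Ring R] (X : R) (k : ℕ) :
    ∃ Q, (1 + X) ^ k = 1 + k * X + X * X * Q := by
  induction k with
  | zero => exact ⟨0, by simp⟩
  | succ k ih =>
    obtain ⟨Q, hQ⟩ := ih
    refine ⟨k + Q + X * Q, ?_⟩
    rw [pow_succ', hQ]
    have : X * (k * X) = k * (X * X) := by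
      rw [← mul_assoc, ← mul_assoc, (Nat.cast_commute k X).eq]
    have h2 : X * X * (k : R) = k * (X * X) := ((Nat.cast_commute k (X * X)).eq).symm
    push_cast
    simp only [mul_add, add_mul, one_mul, mul_one, this, h2, mul_assoc]
    abel

lemma aux_step (n : ℕ) (hn : 2 ≤ n) (A : Matrix (Fin r) (Fin r) ℤ_[l]) :
    ∃ B, (1 + ((l : ℤ_[l]) ^ n) • A) ^ l =
      1 + ((l : ℤ_[l]) ^ (n + 1)) • (A + ((l : ℤ_[l]) ^ 1) • B) := by
  obtain ⟨Q, hQ⟩ := aux_pow (((l : ℤ_[l]) ^ n) • A) l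
  obtain ⟨c, rfl⟩ := Nat.exists_eq_add_of_le hn
  refine ⟨((l : ℤ_[l]) ^ c) • (A * A * Q), ?_⟩
  have h1 : (l : Matrix (Fin r) (Fin r) ℤ_[l]) * (((l : ℤ_[l]) ^ (2 + c)) • A)
      = ((l : ℤ_[l]) ^ (2 + c + 1)) • A := by
    rw [← nsmul_eq_mul, ← Nat.cast_smul_eq_nsmul ℤ_[l], smul_smul]
    congr 1; ring
  rw [hQ, h1]
  simp only [smul_add, smul_smul, smul_mul_assoc, mul_smul_comm, add_assoc]
  congr 3
  ring

lemma aux_iter (n : ℕ) (hn : 2 ≤ n) (k : ℕ) (A : Matrix (Fin r) (Fin r) ℤ_[l]) :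
    ∃ B, (1 + ((l : ℤ_[l]) ^ n) • A) ^ (l ^ k) =
      1 + ((l : ℤ_[l]) ^ (n + k)) • (A + ((l : ℤ_[l]) ^ 1) • B) := by
  induction k with
  | zero => exact ⟨0, by simp⟩
  | succ k ih =>
    obtain ⟨B, hB⟩ := ih
    obtain ⟨C, hC⟩ := aux_step (n + k) (by omega) (A + ((l : ℤ_[l]) ^ 1) • B)
    refine ⟨B + C, ?_⟩
    rw [pow_succ, pow_mul, hB, hC, smul_add _ B C, add_assoc A, add_assoc n]

/-- The image of the n-th congruence layer in the matrices mod `l`. -/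
def auxV (P : Subgroup (GL (Fin r) ℤ_[l])) (n : ℕ) :
    Set (Matrix (Fin r) (Fin r) (ZMod (l ^ 1))) :=
  {a | ∃ g ∈ P, ∃ A : Matrix (Fin r) (Fin r) ℤ_[l],
    (g : Matrix (Fin r) (Fin r) ℤ_[l]) = 1 + ((l : ℤ_[l]) ^ n) • A ∧
    A.map (PadicInt.toZModPow 1) = a}

lemma auxV_step (P : Subgroup (GL (Fin r) ℤ_[l])) (n : ℕ) (hn : 2 ≤ n) :
    auxV P n ⊆ auxV P (n + 1) := by
  rintro a ⟨g, hg, A, hA, rfl⟩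
  obtain ⟨B, hB⟩ := aux_step n hn A
  exact ⟨g ^ l, P.pow_mem hg l, _, by rw [Units.val_pow_eq_pow_val, hA, hB],
    (aux_cong 1 _ _).2 ⟨B, rfl⟩⟩

lemma auxV_stab (P : Subgroup (GL (Fin r) ℤ_[l])) :
    ∃ N, 2 ≤ N ∧ ∀ m, N ≤ m → auxV P m = auxV P N := by
  have : NeZero (l ^ 1) := ⟨pow_ne_zero _ (Fact.out : l.Prime).ne_zero⟩
  have : Finite (Matrix (Fin r) (Fin r) (ZMod (l ^ 1))) := by unfold Matrix; infer_instance
  let f : ℕ →o Set (Matrix (Fin r) (Fin r) (ZMod (l ^ 1))) :=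
    ⟨fun n => auxV P (n + 2), monotone_nat_of_le_succ fun n => auxV_step P (n + 2) (by omega)⟩
  obtain ⟨n, hn⟩ := WellFoundedGT.monotone_chain_condition f
  refine ⟨n + 2, by omega, fun m hm => ?_⟩
  have := hn (m - 2) (by omega)
  have h2 : m - 2 + 2 = m := by omega
  simp only [f, OrderHom.coe_mk, h2] at this
  exact this.symm

lemma aux_reps (P : Subgroup (GL (Fin r) ℤ_[l])) (n : ℕ) :
    ∃ S : Set P, S.Finite ∧ ∀ g : P, ∃ s ∈ S, ∃ B : Matrix (Fin r) (Fin r) ℤ_[l],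
      ((s : GL (Fin r) ℤ_[l]) : Matrix (Fin r) (Fin r) ℤ_[l]) =
        ((g : GL (Fin r) ℤ_[l]) : Matrix (Fin r) (Fin r) ℤ_[l]) + ((l : ℤ_[l]) ^ n) • B := by
  have : NeZero (l ^ n) := ⟨pow_ne_zero _ (Fact.out : l.Prime).ne_zero⟩
  have : Finite (Matrix (Fin r) (Fin r) (ZMod (l ^ n))) := by unfold Matrix; infer_instance
  let f : P → Matrix (Fin r) (Fin r) (ZMod (l ^ n)) := fun g =>
    ((g : GL (Fin r) ℤ_[l]) : Matrix (Fin r) (Fin r) ℤ_[l]).map (PadicInt.toZModPow n)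
  refine ⟨Set.range fun x : Set.range f => x.2.choose, Set.finite_range _, fun g => ?_⟩
  refine ⟨_, ⟨⟨f g, g, rfl⟩, rfl⟩, ?_⟩
  rw [← aux_cong]
  exact (⟨f g, g, rfl⟩ : Set.range f).2.choose_spec

lemma aux_tendsto (A : Matrix (Fin r) (Fin r) ℤ_[l]) (B : ℕ → Matrix (Fin r) (Fin r) ℤ_[l]) :
    Filter.Tendsto (fun m => A + ((l : ℤ_[l]) ^ m) • B m) Filter.atTop (nhds A) := by
  refine tendsto_pi_nhds.2 fun i => tendsto_pi_nhds.2 fun j => ?_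
  simp only [Matrix.add_apply, Matrix.smul_apply, smul_eq_mul]
  have h : Filter.Tendsto (fun m => (l : ℤ_[l]) ^ m * B m i j) Filter.atTop (nhds 0) := by
    refine squeeze_zero_norm (a := fun m => ‖(l : ℤ_[l])‖ ^ m) (fun m => ?_) ?_
    · rw [norm_mul, norm_pow]
      exact mul_le_of_le_one_right (by positivity) (PadicInt.norm_le_one _)
    · refine tendsto_pow_atTop_nhds_zero_of_lt_one (norm_nonneg _) ?_
      rw [PadicInt.norm_p]
      exact inv_lt_one_of_one_lt₀ (by exact_mod_cast (Fact.out : l.Prime).one_lt)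
  simpa using h.const_add (A i j)

end aux

/-- Every closed subgroup `Π` of `GL_r(ℤ_ℓ)` is topologically finitely generated: there is
a finite subset `S ⊆ Π` such that the closure of the subgroup generated by `S` is all
of `Π`. -/
theorem closed_subgroup_topologically_finitely_generated (l : ℕ) [Fact (Nat.Prime l)]
    (r : ℕ) (P : Subgroup (GL (Fin r) ℤ_[l])) (hP : IsClosed (P : Set (GL (Fin r) ℤ_[l]))) :
    ∃ S : Set ↥P, S.Finite ∧ (Subgroup.closure S).topologicalClosure = ⊤ := by
  obtain ⟨N, hN, hV⟩ := auxV_stab P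
  obtain ⟨S, hS, hrep⟩ := aux_reps P (N + 1)
  refine ⟨S, hS, ?_⟩
  set H := Subgroup.closure S with hH
  have key : ∀ k : ℕ, ∀ g : P, ∃ h ∈ H, ∃ B : Matrix (Fin r) (Fin r) ℤ_[l],
      ((h : GL (Fin r) ℤ_[l]) : Matrix (Fin r) (Fin r) ℤ_[l]) =
        ((g : GL (Fin r) ℤ_[l]) : Matrix (Fin r) (Fin r) ℤ_[l])
          + ((l : ℤ_[l]) ^ (N + 1 + k)) • B := by
    intro k
    induction k with
    | zero =>
      intro g
      obtain ⟨s, hs, B, hB⟩ := hrep g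
      exact ⟨s, Subgroup.subset_closure hs, B, hB⟩
    | succ k ih =>
      intro g
      obtain ⟨h, hh, B, hB⟩ := ih g
      have hinv : (((h : GL (Fin r) ℤ_[l])⁻¹ : GL (Fin r) ℤ_[l]) :
          Matrix (Fin r) (Fin r) ℤ_[l]) * ((h : GL (Fin r) ℤ_[l]) :
          Matrix (Fin r) (Fin r) ℤ_[l]) = 1 := Units.inv_mul _
      have hinv' : ((h : GL (Fin r) ℤ_[l]) :
          Matrix (Fin r) (Fin r) ℤ_[l]) * (((h : GL (Fin r) ℤ_[l])⁻¹ : GL (Fin r) ℤ_[l]) :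
          Matrix (Fin r) (Fin r) ℤ_[l])  = 1 := Units.mul_inv _
      have hg : ((g : GL (Fin r) ℤ_[l]) : Matrix (Fin r) (Fin r) ℤ_[l]) =
          ((h : GL (Fin r) ℤ_[l]) : Matrix (Fin r) (Fin r) ℤ_[l])
          - ((l : ℤ_[l]) ^ (N + 1 + k)) • B := by rw [hB]; abel
      generalize hI : (((h : GL (Fin r) ℤ_[l])⁻¹ : GL (Fin r) ℤ_[l]) :
          Matrix (Fin r) (Fin r) ℤ_[l]) = I at hinv hinv'
      have hmem : (-(I * B)).map (PadicInt.toZModPow 1) ∈ auxV P (N + 1 + k) := by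
        refine ⟨(h : GL (Fin r) ℤ_[l])⁻¹ * g, P.mul_mem (P.inv_mem h.2) g.2, -(I * B), ?_, rfl⟩
        rw [Units.val_mul, hI, hg, mul_sub, hinv, mul_smul_comm, smul_neg, sub_eq_add_neg]
      rw [hV _ (by omega)] at hmem
      obtain ⟨g', hg', A', hA', hcong⟩ := hmem
      obtain ⟨D, hD⟩ := (aux_cong 1 _ _).1 hcong
      obtain ⟨s, hs, C, hC⟩ := hrep ⟨g', hg'⟩
      have hs1 : ((s : GL (Fin r) ℤ_[l]) : Matrix (Fin r) (Fin r) ℤ_[l]) =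
          1 + ((l : ℤ_[l]) ^ N) • (A' + ((l : ℤ_[l]) ^ 1) • C) := by
        rw [hC]
        simp only [hA', smul_add, smul_smul, pow_succ, pow_zero, one_mul, add_assoc]
      obtain ⟨E, hE⟩ := aux_iter N hN (1 + k) (A' + ((l : ℤ_[l]) ^ 1) • C)
      refine ⟨h * s ^ (l ^ (1 + k)), H.mul_mem hh (H.pow_mem (Subgroup.subset_closure hs) _),
        ((h : GL (Fin r) ℤ_[l]) : Matrix (Fin r) (Fin r) ℤ_[l]) * (D + C + E), ?_⟩
      rw [Subgroup.coe_mul, Units.val_mul, Subgroup.coe_pow, Units.val_pow_eq_pow_val, hs1, hE,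
        hD, hg, ← add_assoc N 1 k, ← add_assoc (N + 1) k 1]
      have hIB : ((h : GL (Fin r) ℤ_[l]) : Matrix (Fin r) (Fin r) ℤ_[l]) * (I * B) = B := by
        rw [← mul_assoc, hinv', one_mul]
      simp only [mul_add, mul_one, mul_smul_comm, smul_add, mul_neg, hIB, smul_smul, pow_succ,
        pow_zero, one_mul, smul_neg]
      abel
  rw [eq_top_iff]
  intro g _
  choose h hh B hB using fun k => key k g
  have hlim : Filter.Tendsto h Filter.atTop (nhds g) := by
    rw [tendsto_subtype_rng, Units.isInducing_embedProduct.tendsto_nhds_iff]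
    refine Filter.Tendsto.prodMk_nhds ?_ ?_
    · have := aux_tendsto ((g : GL (Fin r) ℤ_[l]) : Matrix (Fin r) (Fin r) ℤ_[l])
        (fun m => ((l : ℤ_[l]) ^ (N + 1)) • B m)
      refine this.congr fun m => ?_
      change _ = ((h m : GL (Fin r) ℤ_[l]) : Matrix (Fin r) (Fin r) ℤ_[l])
      rw [hB, smul_smul, ← pow_add, add_comm m]
    · refine (MulOpposite.continuous_op.tendsto _).comp ?_
      have := aux_tendsto (((g : GL (Fin r) ℤ_[l])⁻¹ : GL (Fin r) ℤ_[l]) :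
          Matrix (Fin r) (Fin r) ℤ_[l])
        (fun m => -(((l : ℤ_[l]) ^ (N + 1)) • ((((h m : GL (Fin r) ℤ_[l])⁻¹ : GL (Fin r) ℤ_[l]) :
          Matrix (Fin r) (Fin r) ℤ_[l]) * B m * (((g : GL (Fin r) ℤ_[l])⁻¹ : GL (Fin r) ℤ_[l]) :
          Matrix (Fin r) (Fin r) ℤ_[l]))))
      refine this.congr fun m => ?_
      change _ = (((h m : GL (Fin r) ℤ_[l])⁻¹ : GL (Fin r) ℤ_[l]) : Matrix (Fin r) (Fin r) ℤ_[l])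
      have e1 : ((l : ℤ_[l]) ^ (N + 1 + m)) • B m =
          ((h m : GL (Fin r) ℤ_[l]) : Matrix (Fin r) (Fin r) ℤ_[l]) -
          ((g : GL (Fin r) ℤ_[l]) : Matrix (Fin r) (Fin r) ℤ_[l]) := by rw [hB]; abel
      rw [smul_neg, smul_smul, ← pow_add, add_comm m, ← smul_mul_assoc, ← mul_smul_comm, e1,
        mul_sub, sub_mul, Units.inv_mul, mul_assoc, Units.mul_inv]
      simp
  exact mem_closure_of_tendsto hlim (Filter.Eventually.of_forall hh)
end

section
/- Let k be an algebraically closed field of characteristic p > 0. Every finite subgroup of PGL₂(k) is isomorphic, as an abstract group, to one of the following: a cyclic group; a dihedral group D_{2m} of order 2m for some m > 0; the alternating group A₄; the alternating group A₅; the symmetric group S₄; a group H fitting in an extension 1 → A → H → Q → 1 with A an elementary abelian p-group and Q a cyclic group of order coprime to p; PSL₂(𝔽_{p^r}) for some r > 0; or PGL₂(𝔽_{p^r}) for some r > 0. -/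
open Matrix

/-- `PGL₂(k)`: the quotient of `GL₂(k)` by its center. -/
abbrev PGL2 (k : Type*) [Field k] : Type _ :=
  GL (Fin 2) k ⧸ Subgroup.center (GL (Fin 2) k)

/-! ### Part 1: abstract group theory -/

/-- No nontrivial normal cyclic subgroup. -/
def NNC (G : Type*) [Group G] : Prop :=
  ∀ N : Subgroup G, N.Normal → IsCyclic N → N = ⊥

theorem NNC.no_unique_sylow {G : Type*} [Group G] [Finite G] (hG : NNC G)
    (K : Subgroup G) (hKn : K.Normal) (r m : ℕ) [hr : Fact r.Prime] (hK : Nat.card K = r * m)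
    (hm : ¬ r ∣ m) (h : ∀ d, d ∣ m → d % r = 1 → d = 1) : False := by
  obtain ⟨P⟩ : Nonempty (Sylow r K) := inferInstance
  have hm0 : m ≠ 0 := by rintro rfl; simp at hm
  have hPc : Nat.card P = r := by
    rw [P.card_eq_multiplicity, hK, Nat.factorization_mul hr.out.ne_zero hm0]
    simp [hr.out.factorization_self, Nat.factorization_eq_zero_of_not_dvd hm]
  have hidx : (P : Subgroup K).index = m := by
    have := (P : Subgroup K).card_mul_index
    rw [hPc, hK] at this
    exact Nat.eq_of_mul_eq_mul_left hr.out.pos this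
  have h1 : Nat.card (Sylow r K) = 1 := by
    apply h
    · rw [← hidx]; exact P.card_dvd_index
    · have := card_sylow_modEq_one r K
      rw [Nat.ModEq, Nat.mod_eq_of_lt hr.out.one_lt] at this
      exact this
  have hs : Subsingleton (Sylow r K) := (Nat.card_eq_one_iff_unique.mp h1).1
  have hch : (P : Subgroup K).Characteristic := P.characteristic_of_subsingleton
  have hN : ((P : Subgroup K).map K.subtype).Normal := inferInstance
  have hcard : Nat.card ((P : Subgroup K).map K.subtype) = r := by
    rw [Subgroup.card_map_of_injective K.subtype_injective]; exact hPc
  have hb := hG _ hN (isCyclic_of_prime_card hcard)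
  rw [hb, Subgroup.card_bot] at hcard
  exact hr.out.one_lt.ne hcard

theorem NNC.card_sylow_ne_one {G : Type*} [Group G] [Finite G] (hG : NNC G)
    (r m : ℕ) [hr : Fact r.Prime] (hc : Nat.card G = r * m) (hm : ¬ r ∣ m) :
    Nat.card (Sylow r G) ≠ 1 := by
  intro h1
  obtain ⟨P⟩ : Nonempty (Sylow r G) := inferInstance
  have hm0 : m ≠ 0 := by rintro rfl; simp at hm
  have hPc : Nat.card P = r := by
    rw [P.card_eq_multiplicity, hc, Nat.factorization_mul hr.out.ne_zero hm0]
    simp [hr.out.factorization_self, Nat.factorization_eq_zero_of_not_dvd hm]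
  have hs : Subsingleton (Sylow r G) := (Nat.card_eq_one_iff_unique.mp h1).1
  have hb := hG _ P.normal_of_subsingleton (isCyclic_of_prime_card hPc)
  have hPc' : Nat.card (P : Subgroup G) = r := hPc
  rw [hb, Subgroup.card_bot] at hPc'
  exact hr.out.one_lt.ne hPc'

theorem subsingleton_sylow_of_ker {G : Type*} [Group G] [Finite G] (r a : ℕ) [hr : Fact r.Prime]
    (hP : ∀ P : Sylow r G, Nat.card P = r ^ a)
    (hK : r ^ a ∣ Nat.card (MulAction.toPermHom G (Sylow r G)).ker) :
    Nat.card (Sylow r G) = 1 := by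
  obtain ⟨K, hKdef⟩ : ∃ K, K = (MulAction.toPermHom G (Sylow r G)).ker := ⟨_, rfl⟩
  rw [← hKdef] at hK
  obtain ⟨Q, hQ⟩ := Sylow.exists_subgroup_card_pow_prime r hK
  have hQ' : Nat.card (Q.map K.subtype) = r ^ a := by
    rw [Subgroup.card_map_of_injective K.subtype_injective]; exact hQ
  have hp : IsPGroup r (Q.map K.subtype) := IsPGroup.of_card hQ'
  have key : ∀ P : Sylow r G, Q.map K.subtype = (P : Subgroup G) := by
    intro P
    have hle : Q.map K.subtype ≤ (P : Subgroup G) := by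
      rw [← hp.sylow_mem_fixedPoints_iff]
      rintro ⟨g, hg⟩
      have : g ∈ K := Subgroup.map_subtype_le _ hg
      rw [hKdef, MonoidHom.mem_ker] at this
      have := congrArg (fun f => f P) this
      simpa using this
    exact Subgroup.eq_of_le_of_card_ge hle (by rw [hQ']; exact (hP P).le)
  rw [Nat.card_eq_one_iff_unique]
  exact ⟨⟨fun P P' => Sylow.ext ((key P).symm.trans (key P'))⟩, inferInstance⟩

theorem card_sylow_dvd_index_ker {G : Type*} [Group G] [Finite G] (r : ℕ) [hr : Fact r.Prime] :
    Nat.card (Sylow r G) ∣ (MulAction.toPermHom G (Sylow r G)).ker.index := by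
  obtain ⟨P⟩ : Nonempty (Sylow r G) := inferInstance
  rw [P.card_eq_index_normalizer]
  apply Subgroup.index_dvd_of_le
  rw [← P.stabilizer_eq_normalizer]
  intro g hg
  rw [MonoidHom.mem_ker] at hg
  have := congrArg (fun f => f P) hg
  simpa using this

/-- An injection into a symmetric group with image of index one or two. -/
theorem iso_perm_of_injective {G X : Type*} [Group G] [Finite G] [Finite X] (f : G →* Equiv.Perm X)
    (hf : Function.Injective f) (n : ℕ) (hX : Nat.card X = n) (hG : Nat.card G = n.factorial) :
    Nonempty (G ≃* Equiv.Perm (Fin n)) := by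
  have e : X ≃ Fin n := Finite.equivFinOfCardEq hX
  have hb : Function.Bijective f := by
    rw [Nat.bijective_iff_injective_and_card]
    exact ⟨hf, by rw [hG, Nat.card_perm, hX]⟩
  exact ⟨(MulEquiv.ofBijective f hb).trans e.permCongrHom⟩

theorem iso_alt_of_injective {G X : Type*} [Group G] [Finite G] [Finite X] (f : G →* Equiv.Perm X)
    (hf : Function.Injective f) (n : ℕ) (_hn : 1 < n)
    (hX : Nat.card X = n) (hG : 2 * Nat.card G = n.factorial) :
    Nonempty (G ≃* alternatingGroup (Fin n)) := by
  have e : X ≃ Fin n := Finite.equivFinOfCardEq hX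
  let f' : G →* Equiv.Perm (Fin n) := e.permCongrHom.toMonoidHom.comp f
  have hf' : Function.Injective f' := e.permCongrHom.injective.comp hf
  have hc : Nat.card f'.range = Nat.card G := by
    exact (Nat.card_congr (MonoidHom.ofInjective hf').toEquiv).symm
  have hi : f'.range.index = 2 := by
    have := f'.range.card_mul_index
    rw [hc, Nat.card_perm, Nat.card_fin, ← hG, mul_comm 2] at this
    exact Nat.eq_of_mul_eq_mul_left Nat.card_pos this
  have : f'.range = alternatingGroup (Fin n) := Equiv.Perm.eq_alternatingGroup_of_index_eq_two hi
  exact ⟨(MonoidHom.ofInjective hf').trans (MulEquiv.subgroupCongr this)⟩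

theorem NNC.card12 {G : Type*} [Group G] [Finite G] (hG : NNC G) (h : Nat.card G = 12) :
    Nonempty (G ≃* alternatingGroup (Fin 4)) := by
  have : Fact (Nat.Prime 3) := ⟨by norm_num⟩
  have hne := hG.card_sylow_ne_one 3 4 h (by norm_num)
  have hP : ∀ P : Sylow 3 G, Nat.card P = 3 ^ 1 := by
    intro P
    rw [P.card_eq_multiplicity, h, show (12 : ℕ) = 3 * 4 from rfl,
      Nat.factorization_mul (by norm_num) (by norm_num)]
    simp [this.out.factorization_self, Nat.factorization_eq_zero_of_not_dvd]
  have h4 : Nat.card (Sylow 3 G) = 4 := by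
    obtain ⟨P⟩ : Nonempty (Sylow 3 G) := inferInstance
    have h1 := P.card_dvd_index
    have h2 := (P : Subgroup G).card_mul_index
    have h3 := card_sylow_modEq_one 3 G
    have h5 : Nat.card (P : Subgroup G) = 3 := by simpa using hP P
    rw [h5, h] at h2
    have h6 : (P : Subgroup G).index = 4 := by omega
    rw [h6] at h1
    have := Nat.le_of_dvd (by norm_num) h1
    rw [Nat.ModEq] at h3
    interval_cases hh : Nat.card (Sylow 3 G) <;> simp_all
  have hk : ¬ 3 ∣ Nat.card (MulAction.toPermHom G (Sylow 3 G)).ker := by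
    intro hd
    exact hne (subsingleton_sylow_of_ker 3 1 hP (by simpa using hd))
  have hi := card_sylow_dvd_index_ker (G := G) 3
  have hm := (MulAction.toPermHom G (Sylow 3 G)).ker.card_mul_index
  have hb : (MulAction.toPermHom G (Sylow 3 G)).ker = ⊥ := by
    rw [← Subgroup.card_eq_one]
    rw [h4] at hi
    obtain ⟨c, hc⟩ := hi
    rw [hc, h] at hm
    have : Nat.card (MulAction.toPermHom G (Sylow 3 G)).ker ∣ 3 := ⟨c, by nlinarith⟩
    rcases (Nat.dvd_prime (by norm_num)).mp this with h1 | h1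
    · exact h1
    · exact absurd (dvd_of_eq h1.symm) hk
  exact iso_alt_of_injective _ ((MonoidHom.ker_eq_bot_iff _).mp hb) 4 (by norm_num) h4
    (by rw [h]; rfl)

theorem NNC.card24 {G : Type*} [Group G] [Finite G] (hG : NNC G) (h : Nat.card G = 24) :
    Nonempty (G ≃* Equiv.Perm (Fin 4)) := by
  have : Fact (Nat.Prime 3) := ⟨by norm_num⟩
  have hne := hG.card_sylow_ne_one 3 8 h (by norm_num)
  have hP : ∀ P : Sylow 3 G, Nat.card P = 3 ^ 1 := by
    intro P
    rw [P.card_eq_multiplicity, h, show (24 : ℕ) = 3 * 8 from rfl,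
      Nat.factorization_mul (by norm_num) (by norm_num)]
    simp [this.out.factorization_self, Nat.factorization_eq_zero_of_not_dvd]
  have h4 : Nat.card (Sylow 3 G) = 4 := by
    obtain ⟨P⟩ : Nonempty (Sylow 3 G) := inferInstance
    have h1 := P.card_dvd_index
    have h2 := (P : Subgroup G).card_mul_index
    have h3 := card_sylow_modEq_one 3 G
    have h5 : Nat.card (P : Subgroup G) = 3 := by simpa using hP P
    rw [h5, h] at h2
    have h6 : (P : Subgroup G).index = 8 := by omega
    rw [h6] at h1
    have := Nat.le_of_dvd (by norm_num) h1
    rw [Nat.ModEq] at h3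
    interval_cases hh : Nat.card (Sylow 3 G) <;> simp_all
  have hk : ¬ 3 ∣ Nat.card (MulAction.toPermHom G (Sylow 3 G)).ker := by
    intro hd
    exact hne (subsingleton_sylow_of_ker 3 1 hP (by simpa using hd))
  have hi := card_sylow_dvd_index_ker (G := G) 3
  have hm := (MulAction.toPermHom G (Sylow 3 G)).ker.card_mul_index
  have hb : (MulAction.toPermHom G (Sylow 3 G)).ker = ⊥ := by
    rw [h4] at hi
    obtain ⟨c, hc⟩ := hi
    rw [hc, h] at hm
    have h6 : Nat.card (MulAction.toPermHom G (Sylow 3 G)).ker ∣ 6 := ⟨c, by nlinarith⟩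
    have hle := Nat.le_of_dvd (by norm_num) h6
    have h2 : Nat.card (MulAction.toPermHom G (Sylow 3 G)).ker = 1 ∨
        Nat.card (MulAction.toPermHom G (Sylow 3 G)).ker = 2 := by
      interval_cases hh : Nat.card (MulAction.toPermHom G (Sylow 3 G)).ker <;> simp_all
    rcases h2 with h1 | h1
    · rwa [Subgroup.card_eq_one] at h1
    · have : Fact (Nat.Prime 2) := ⟨by norm_num⟩
      exact hG _ inferInstance (isCyclic_of_prime_card h1)
  exact iso_perm_of_injective _ ((MonoidHom.ker_eq_bot_iff _).mp hb) 4 h4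
    (by rw [h]; rfl)

theorem exists_normal_of_unique_sylow {G : Type*} [Group G] [Finite G]
    (r m : ℕ) [hr : Fact r.Prime] (hK : Nat.card G = r * m)
    (hm : ¬ r ∣ m) (h : ∀ d, d ∣ m → d % r = 1 → d = 1) :
    ∃ P : Subgroup G, P.Normal ∧ Nat.card P = r ∧ P.index = m := by
  obtain ⟨P⟩ : Nonempty (Sylow r G) := inferInstance
  have hm0 : m ≠ 0 := by rintro rfl; simp at hm
  have hPc : Nat.card P = r := by
    rw [P.card_eq_multiplicity, hK, Nat.factorization_mul hr.out.ne_zero hm0]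
    simp [hr.out.factorization_self, Nat.factorization_eq_zero_of_not_dvd hm]
  have hidx : (P : Subgroup G).index = m := by
    have := (P : Subgroup G).card_mul_index
    rw [hPc, hK] at this
    exact Nat.eq_of_mul_eq_mul_left hr.out.pos this
  have h1 : Nat.card (Sylow r G) = 1 := by
    apply h
    · rw [← hidx]; exact P.card_dvd_index
    · have := card_sylow_modEq_one r G
      rw [Nat.ModEq, Nat.mod_eq_of_lt hr.out.one_lt] at this
      exact this
  have hs : Subsingleton (Sylow r G) := (Nat.card_eq_one_iff_unique.mp h1).1
  exact ⟨P, P.normal_of_subsingleton, hPc, hidx⟩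

theorem NNC.card60 {G : Type*} [Group G] [Finite G] (hG : NNC G) (h : Nat.card G = 60) :
    Nonempty (G ≃* alternatingGroup (Fin 5)) := by
  have f2 : Fact (Nat.Prime 2) := ⟨by norm_num⟩
  have f3 : Fact (Nat.Prime 3) := ⟨by norm_num⟩
  have f5 : Fact (Nat.Prime 5) := ⟨by norm_num⟩
  have hP : ∀ P : Sylow 2 G, Nat.card P = 2 ^ 2 := by
    intro P
    have h60 : Nat.factorization (2 ^ 2 * 15) 2 = 2 := by
      rw [Nat.factorization_mul (by positivity) (by norm_num), Nat.factorization_pow,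
        Finsupp.add_apply, Finsupp.smul_apply, f2.out.factorization_self,
        Nat.factorization_eq_zero_of_not_dvd (by norm_num : ¬ 2 ∣ 15)]
      rfl
    rw [P.card_eq_multiplicity, h, show (60 : ℕ) = 2 ^ 2 * 15 from rfl, h60]
  obtain ⟨P⟩ : Nonempty (Sylow 2 G) := inferInstance
  have hPc : Nat.card (P : Subgroup G) = 4 := hP P
  have hPi : (P : Subgroup G).index = 15 := by
    have h2 := (P : Subgroup G).card_mul_index
    rw [hPc, h] at h2; omega
  have hn : Nat.card (Sylow 2 G) ∣ 15 := hPi ▸ P.card_dvd_index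
  have hi := card_sylow_dvd_index_ker (G := G) 2
  have hm := (MulAction.toPermHom G (Sylow 2 G)).ker.card_mul_index
  rw [h] at hm
  have h4 : Nat.card (Sylow 2 G) = 1 ∨ Nat.card (Sylow 2 G) = 3 ∨ Nat.card (Sylow 2 G) = 5 ∨
      Nat.card (Sylow 2 G) = 15 := by
    have := Nat.le_of_dvd (by norm_num) hn
    generalize Nat.card (Sylow 2 G) = a at *
    clear hi hm
    interval_cases a <;> simp_all
  rcases h4 with h4 | h4 | h4 | h4
  · exfalso
    have hs : Subsingleton (Sylow 2 G) := (Nat.card_eq_one_iff_unique.mp h4).1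
    have hPn := P.normal_of_subsingleton
    have hq : Nat.card (G ⧸ (P : Subgroup G)) = 5 * 3 := by
      rw [← Subgroup.index_eq_card, hPi]
    obtain ⟨Q, hQn, hQc, hQi⟩ := exists_normal_of_unique_sylow 5 3 hq (by norm_num) (by
      intro d hd h1
      have := Nat.le_of_dvd (by norm_num) hd
      interval_cases d <;> simp_all)
    have hL : (Q.comap (QuotientGroup.mk' (P : Subgroup G))).index = 3 := by
      rw [Subgroup.index_comap_of_surjective _ (QuotientGroup.mk'_surjective _), hQi]
    have hLc := (Q.comap (QuotientGroup.mk' (P : Subgroup G))).card_mul_index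
    rw [hL, h] at hLc
    refine hG.no_unique_sylow _ (hQn.comap (QuotientGroup.mk' (P : Subgroup G))) 5 4 (by omega)
      (by norm_num) ?_
    intro d hd h1
    have := Nat.le_of_dvd (by norm_num) hd
    interval_cases d <;> simp_all
  · exfalso
    have h6 : (MulAction.toPermHom G (Sylow 2 G)).ker.index ∣ 6 := by
      rw [Subgroup.index_ker]
      have := Subgroup.card_subgroup_dvd_card (MulAction.toPermHom G (Sylow 2 G)).range
      rw [Nat.card_perm, h4] at this
      exact this
    rw [h4] at hi
    have hc : ∃ m, (m = 4 ∨ m = 2) ∧ Nat.card (MulAction.toPermHom G (Sylow 2 G)).ker = 5 * m := by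
      generalize Nat.card (MulAction.toPermHom G (Sylow 2 G)).ker = a at *
      have := Nat.le_of_dvd (by norm_num) h6
      generalize (MulAction.toPermHom G (Sylow 2 G)).ker.index = b at *
      interval_cases b <;> simp_all
      all_goals omega
    obtain ⟨m, hm', hc⟩ := hc
    refine hG.no_unique_sylow _ (MonoidHom.normal_ker _) 5 m hc ?_ ?_
    · rcases hm' with rfl | rfl <;> norm_num
    intro d hd h1
    have := Nat.le_of_dvd (by omega) hd
    have : d ≤ 4 := by omega
    interval_cases d <;> simp_all
  · have hk : ¬ 4 ∣ Nat.card (MulAction.toPermHom G (Sylow 2 G)).ker := by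
      intro hd
      have := subsingleton_sylow_of_ker 2 2 hP (by simpa using hd)
      omega
    rw [h4] at hi
    have h12 : Nat.card (MulAction.toPermHom G (Sylow 2 G)).ker ∣ 12 := by
      obtain ⟨c, hc⟩ := hi
      rw [hc] at hm
      exact ⟨c, by nlinarith⟩
    have hcases : Nat.card (MulAction.toPermHom G (Sylow 2 G)).ker = 1 ∨
        Nat.card (MulAction.toPermHom G (Sylow 2 G)).ker = 2 ∨
        Nat.card (MulAction.toPermHom G (Sylow 2 G)).ker = 3 * 1 ∨
        Nat.card (MulAction.toPermHom G (Sylow 2 G)).ker = 3 * 2 := by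
      generalize Nat.card (MulAction.toPermHom G (Sylow 2 G)).ker = a at *
      have := Nat.le_of_dvd (by norm_num) h12
      clear hm hi
      interval_cases a <;> simp_all
    have hb : (MulAction.toPermHom G (Sylow 2 G)).ker = ⊥ := by
      rcases hcases with h1 | h1 | h1 | h1
      · rwa [Subgroup.card_eq_one] at h1
      · exact hG _ inferInstance (isCyclic_of_prime_card h1)
      · exact hG _ inferInstance (isCyclic_of_prime_card h1)
      · exfalso
        refine hG.no_unique_sylow _ (MonoidHom.normal_ker _) 3 2 h1 (by norm_num) ?_
        intro d hd h1
        have := Nat.le_of_dvd (by omega) hd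
        interval_cases d <;> simp_all
    exact iso_alt_of_injective _ ((MonoidHom.ker_eq_bot_iff _).mp hb) 5 (by norm_num) h4
      (by rw [h]; rfl)
  · exfalso
    have hNi := P.card_eq_index_normalizer
    rw [h4] at hNi
    have hN := (Subgroup.normalizer (P : Set G)).card_mul_index
    have hNi' : (Subgroup.normalizer (P : Set G)).index = 15 := hNi.symm
    rw [hNi', h] at hN
    have hPN : (P : Subgroup G) = Subgroup.normalizer (P : Set G) :=
      Subgroup.eq_of_le_of_card_ge Subgroup.le_normalizer (by rw [hPc]; omega)
    have hcomm : ∀ a b : P, a * b = b * a :=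
      (IsPGroup.isMulCommutative_of_card_eq_prime_sq (p := 2) (hP P)).is_comm.comm
    have hle : Subgroup.normalizer (P : Set G) ≤ Subgroup.centralizer (P : Set G) := by
      rw [← hPN]
      intro a ha
      rw [Subgroup.mem_centralizer_iff]
      intro b hb
      exact congrArg Subtype.val (hcomm ⟨b, hb⟩ ⟨a, ha⟩)
    have hcompl := MonoidHom.ker_transferSylow_isComplement' P hle
    have hcc := hcompl.card_mul_card
    rw [hPc, h] at hcc
    refine hG.no_unique_sylow _ (MonoidHom.normal_ker (MonoidHom.transferSylow P hle)) 3 5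
      (by omega) (by norm_num) ?_
    clear hcc hcompl
    intro d hd h1
    have := Nat.le_of_dvd (by omega) hd
    interval_cases d <;> revert hd h1 <;> decide

theorem dihedral_of_index_two {G : Type*} [Group G] [Finite G] (C : Subgroup G) (hC : IsCyclic C)
    (hi : C.index = 2) (hs : ∀ g, g ∉ C → g * g = 1) :
    ∃ m : ℕ, 0 < m ∧ Nonempty (G ≃* DihedralGroup m) := by
  refine ⟨Nat.card C, Nat.card_pos, ?_⟩
  let φ := zmodCyclicMulEquiv hC
  obtain ⟨s, hsC⟩ : ∃ s, s ∉ C := by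
    by_contra hcon
    push Not at hcon
    have : C = ⊤ := (Subgroup.eq_top_iff' C).mpr hcon
    rw [this, Subgroup.index_top] at hi
    omega
  have hss : s * s = 1 := hs s hsC
  have hsinv : s⁻¹ = s := inv_eq_of_mul_eq_one_left hss
  have hcs : ∀ c ∈ C, c * s = s * c⁻¹ := by
    intro c hc
    have h1 : s * c ∉ C := fun h => hsC ((Subgroup.mul_mem_cancel_right C hc).mp h)
    have h2 := hs _ h1
    have h3 : c * s * c = s⁻¹ := by
      rw [eq_inv_iff_mul_eq_one, ← mul_eq_one_comm]; simpa [mul_assoc] using h2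
    rw [hsinv] at h3
    rw [eq_mul_inv_iff_mul_eq, h3]
  let f : DihedralGroup (Nat.card C) → G := fun
    | .r i => (φ (Multiplicative.ofAdd i) : G)
    | .sr i => s * (φ (Multiplicative.ofAdd i) : G)
  have hadd : ∀ i j : ZMod (Nat.card C), (φ (Multiplicative.ofAdd (i + j)) : G) =
      φ (Multiplicative.ofAdd i) * φ (Multiplicative.ofAdd j) := by
    intro i j; rw [ofAdd_add, map_mul]; rfl
  have hsub : ∀ i j : ZMod (Nat.card C), (φ (Multiplicative.ofAdd (i - j)) : G) =
      (φ (Multiplicative.ofAdd j) : G)⁻¹ * φ (Multiplicative.ofAdd i) := by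
    intro i j; rw [sub_eq_neg_add, hadd, ofAdd_neg, map_inv]; rfl
  let F : DihedralGroup (Nat.card C) →* G := MonoidHom.mk' f (by
    rintro (i | i) (j | j)
    · simp only [DihedralGroup.r_mul_r, f, hadd]
    · simp only [DihedralGroup.r_mul_sr, f, hsub]
      rw [← mul_assoc, ← mul_assoc, hcs _ (SetLike.coe_mem _)]
    · simp only [DihedralGroup.sr_mul_r, f, hadd, mul_assoc]
    · simp only [DihedralGroup.sr_mul_sr, f, hsub]
      rw [mul_assoc, ← mul_assoc _ s, hcs _ (SetLike.coe_mem _), mul_assoc, ← mul_assoc s s, hss,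
        one_mul])
  have hF : Function.Injective F := by
    rw [injective_iff_map_eq_one]
    rintro (i | i) h
    · have h' : (φ (Multiplicative.ofAdd i) : G) = 1 := h
      have h2 : φ (Multiplicative.ofAdd i) = 1 := Subtype.ext h'
      rw [map_eq_one_iff φ φ.injective] at h2
      have : i = 0 := h2
      rw [this]; rfl
    · have h' : s * (φ (Multiplicative.ofAdd i) : G) = 1 := h
      exfalso; apply hsC
      rw [eq_inv_of_mul_eq_one_left h']
      exact C.inv_mem (SetLike.coe_mem _)
  have hb : Function.Bijective F := by
    rw [Nat.bijective_iff_injective_and_card]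
    refine ⟨hF, ?_⟩
    rw [DihedralGroup.nat_card, ← C.card_mul_index, hi, mul_comm]
  exact ⟨(MulEquiv.ofBijective F hb).symm⟩

theorem NNC.of_action {G X : Type*} [Group G] [MulAction G X]
    (h1 : ∀ g : G, ∃ x : X, g • x = x)
    (h3 : ∀ (g : G) (x y z : X), x ≠ y → x ≠ z → y ≠ z → g • x = x → g • y = y → g • z = z → g = 1)
    (ho : ∀ x y : X, ∃ g : G, g • x ≠ x ∧ g • x ≠ y) : NNC G := by
  intro N hN hc
  obtain ⟨⟨g, hgN⟩, hg⟩ := hc.exists_generator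
  have hfix : ∀ a ∈ N, ∀ x : X, g • x = x → a • x = x := by
    intro a ha x hx
    obtain ⟨n, hn⟩ := Subgroup.mem_zpowers_iff.mp (hg ⟨a, ha⟩)
    have h2 : g ^ n = a := congrArg Subtype.val hn
    have h4 : g ∈ MulAction.stabilizer G x := hx
    rw [← h2]
    exact Subgroup.zpow_mem _ h4 n
  obtain ⟨x, hx⟩ := h1 g
  have horb : ∀ h : G, g • (h • x) = h • x := by
    intro h
    have := hfix _ (hN.conj_mem g hgN h⁻¹) x hx
    rw [inv_inv, mul_smul, mul_smul, inv_smul_eq_iff] at this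
    exact this
  obtain ⟨a, ha, -⟩ := ho x x
  obtain ⟨b, hb, hb'⟩ := ho x (a • x)
  have hg1 : g = 1 := h3 g x (a • x) (b • x) ha.symm hb.symm hb'.symm hx (horb a) (horb b)
  rw [Subgroup.eq_bot_iff_forall]
  intro y hy
  obtain ⟨n, hn⟩ := Subgroup.mem_zpowers_iff.mp (hg ⟨y, hy⟩)
  have h2 : g ^ n = y := congrArg Subtype.val hn
  rw [← h2, hg1, _root_.one_zpow]

/-! ### Part 3: counting -/

theorem arith_tame_sorted {n t1 t2 t3 e1 e2 e3 : ℕ} (hs : t1 + t2 + t3 = n + 2)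
    (h1 : t1 * e1 = n) (h2 : t2 * e2 = n) (h3 : t3 * e3 = n)
    (_g1 : 3 ≤ t1) (_g2 : 3 ≤ t2) (g3 : 3 ≤ t3) (k1 : 2 ≤ e1)
    (h12 : e1 ≤ e2) (h23 : e2 ≤ e3) : n = 12 ∨ n = 24 ∨ n = 60 := by
  have a1 : e1 < 3 := by
    by_contra h
    nlinarith [Nat.mul_le_mul_left t1 (show 3 ≤ e1 by omega),
      Nat.mul_le_mul_left t2 (show 3 ≤ e2 by omega), Nat.mul_le_mul_left t3 (show 3 ≤ e3 by omega)]
  obtain rfl : e1 = 2 := by omega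
  have a2 : e2 < 4 := by
    by_contra h
    nlinarith [Nat.mul_le_mul_left t2 (show 4 ≤ e2 by omega),
      Nat.mul_le_mul_left t3 (show 4 ≤ e3 by omega)]
  obtain rfl | rfl : e2 = 2 ∨ e2 = 3 := by omega
  · omega
  · have a3 : e3 < 6 := by
      by_contra h
      nlinarith [Nat.mul_le_mul_left t3 (show 6 ≤ e3 by omega)]
    obtain rfl | rfl | rfl : e3 = 3 ∨ e3 = 4 ∨ e3 = 5 := by omega
    all_goals omega

theorem arith_tame {n t1 t2 t3 e1 e2 e3 : ℕ} (hs : t1 + t2 + t3 = n + 2)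
    (h1 : t1 * e1 = n) (h2 : t2 * e2 = n) (h3 : t3 * e3 = n)
    (g1 : 3 ≤ t1) (g2 : 3 ≤ t2) (g3 : 3 ≤ t3) (k1 : 2 ≤ e1) (k2 : 2 ≤ e2) (k3 : 2 ≤ e3) :
    n = 12 ∨ n = 24 ∨ n = 60 := by
  rcases le_total e1 e2 with a | a <;> rcases le_total e2 e3 with b | b <;>
    rcases le_total e1 e3 with c | c
  · exact arith_tame_sorted hs h1 h2 h3 g1 g2 g3 k1 a b
  · exact arith_tame_sorted hs h1 h2 h3 g1 g2 g3 k1 a b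
  · exact arith_tame_sorted (by omega) h1 h3 h2 g1 g3 g2 k1 c b
  · exact arith_tame_sorted (by omega) h3 h1 h2 g3 g1 g2 k3 c a
  · exact arith_tame_sorted (by omega) h2 h1 h3 g2 g1 g3 k2 a c
  · exact arith_tame_sorted (by omega) h2 h3 h1 g2 g3 g1 k2 b c
  · exact arith_tame_sorted (by omega) h3 h2 h1 g3 g2 g1 k3 b a
  · exact arith_tame_sorted (by omega) h3 h2 h1 g3 g2 g1 k3 b a

theorem arith_wild {n t q e T d : ℕ} (hn : t * (q * e) = n) (hq : 1 < q) (he : e ∣ q - 1)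
    (ht : q ∣ t - 1) (ht3 : 3 ≤ t) (hT : T = 2 + t * (q - 2)) (hT3 : 3 ≤ T) (hd : T * d = n) :
    n = 60 ∨ (t = q + 1 ∧ q - 1 ≤ 2 * e) := by
  obtain ⟨s, hs⟩ := ht
  obtain rfl : t = 1 + q * s := by omega
  have hs1 : 1 ≤ s := by
    rcases Nat.eq_zero_or_pos s with rfl | h
    · omega
    · exact h
  obtain ⟨r, rfl⟩ : ∃ r, q = r + 2 := ⟨q - 2, by omega⟩
  have hr : 1 ≤ r := by
    rcases Nat.eq_zero_or_pos r with rfl | h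
    · simp at hT; omega
    · exact h
  simp only [Nat.add_sub_cancel, show r + 2 - 1 = r + 1 by omega] at *
  have heq : e * (1 + (r + 2) * s) = d * (1 + r * s) := by
    have : (r + 2) * (e * (1 + (r + 2) * s)) = (r + 2) * (d * (1 + r * s)) := by
      rw [hT] at hd
      calc _ = n := by rw [← hn]; ring
        _ = _ := by rw [← hd]; ring
    exact Nat.eq_of_mul_eq_mul_left (by omega) this
  have hdvd : (1 + r * s) ∣ 2 * e := by
    have h1 : (1 + r * s) ∣ (2 * e) * s := by
      have h2 : (1 + r * s) ∣ e * (1 + (r + 2) * s) := ⟨d, by rw [heq]; ring⟩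
      have h3 : e * (1 + (r + 2) * s) = e * (1 + r * s) + (2 * e) * s := by ring
      rw [h3] at h2
      exact (Nat.dvd_add_right (Dvd.intro_left _ rfl)).mp h2
    have hc : Nat.Coprime (1 + r * s) s := by simp
    exact hc.dvd_of_dvd_mul_right h1
  have hele : e ≤ r + 1 := Nat.le_of_dvd (by omega) he
  have he0 : 0 < e := Nat.pos_of_dvd_of_pos he (by omega)
  have hle := Nat.le_of_dvd (by omega) hdvd
  obtain ⟨j, hj⟩ := hdvd
  obtain h1 | h1 | h1 : s = 1 ∨ s = 2 ∨ 3 ≤ s := by omega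
  · subst h1
    right
    constructor <;> omega
  · subst h1
    exfalso
    have : j < 2 := by
      by_contra h
      nlinarith [Nat.mul_le_mul_left (1 + r * 2) (show 2 ≤ j by omega)]
    interval_cases j <;> omega
  · have : r = 1 := by nlinarith [Nat.mul_le_mul_left r h1]
    subst this
    left
    have hs3 : s = 3 := by omega
    subst hs3
    have : e = 2 := by omega
    subst this
    omega

theorem free_dvd {Γ X : Type*} [Group Γ] [MulAction Γ X] (S : Set X)
    (hinv : ∀ (g : Γ), ∀ x ∈ S, g • x ∈ S) (hfree : ∀ (g : Γ), ∀ x ∈ S, g • x = x → g = 1) :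
    Nat.card Γ ∣ Nat.card S := by
  let A : SubMulAction Γ X := ⟨S, fun g {x} hx => hinv g x hx⟩
  have e := MulAction.selfEquivOrbitsQuotientProd (G := Γ) (X := A) (by
    rintro ⟨x, hx⟩
    rw [Subgroup.eq_bot_iff_forall]
    intro g hg
    exact hfree g x hx (congrArg Subtype.val hg))
  have := Nat.card_congr e
  rw [Nat.card_prod] at this
  exact ⟨_, this.trans (mul_comm _ _)⟩

/-- number of nontrivial elements whose only fixed point is `x` -/
noncomputable def uCard (G : Type*) {X : Type*} [Group G] [MulAction G X] (x : X) : ℕ :=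
  Nat.card {g : G // g ≠ 1 ∧ ∀ y : X, g • y = y ↔ y = x}

theorem uCard_smul {G X : Type*} [Group G] [MulAction G X] (h : G) (x : X) :
    uCard G (h • x) = uCard G x := by
  unfold uCard
  apply Nat.card_congr
  refine (Equiv.subtypeEquiv (MulAut.conj h).toEquiv ?_).symm
  intro g
  constructor
  · rintro ⟨h1, h2⟩
    refine ⟨by simpa using h1, fun y => ?_⟩
    have := h2 (h⁻¹ • y)
    simp only [MulEquiv.toEquiv_eq_coe, EquivLike.coe_coe, MulAut.conj_apply, mul_smul]
    rw [inv_smul_eq_iff] at this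
    rw [← this, eq_inv_smul_iff]
  · rintro ⟨h1, h2⟩
    refine ⟨by simpa using h1, fun y => ?_⟩
    have := h2 (h • y)
    simpa [mul_smul] using this

theorem count_fixed {G X : Type*} [Group G] [Finite G] [MulAction G X] [Nonempty X]
    (hF : ∀ g : G, g ≠ 1 → ∃ a b : X, ∀ x, g • x = x ↔ x = a ∨ x = b) :
    ∃ S : Finset X, (∀ x, x ∈ S ↔ ∃ g : G, g ≠ 1 ∧ g • x = x) ∧
      ∑ x ∈ S, ((Nat.card (MulAction.stabilizer G x) - 1) + uCard G x) = 2 * (Nat.card G - 1) := by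
  classical
  have := Fintype.ofFinite G
  choose! a b hab using hF
  let N : Finset G := Finset.univ.erase 1
  let S : Finset X := N.biUnion (fun g => {a g, b g})
  have hS : ∀ x, x ∈ S ↔ ∃ g : G, g ≠ 1 ∧ g • x = x := by
    intro x
    simp only [S, N, Finset.mem_biUnion, Finset.mem_erase, Finset.mem_univ, and_true,
      Finset.mem_insert, Finset.mem_singleton]
    exact exists_congr fun g => and_congr_right fun hg => (hab g hg x).symm
  refine ⟨S, hS, ?_⟩
  have h1 : ∀ x : X, Nat.card (MulAction.stabilizer G x) - 1 = ∑ g ∈ N, if g • x = x then 1 else 0 := by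
    intro x
    rw [← Finset.card_filter]
    have : N.filter (fun g => g • x = x) =
        (Finset.univ.filter (fun g : G => g • x = x)).erase 1 := by
      ext g; simp [N]
    rw [this, Finset.card_erase_of_mem (by simp)]
    congr 1
    rw [← Fintype.card_subtype, ← Nat.card_eq_fintype_card]
    rfl
  have h2 : ∀ x : X, uCard G x = ∑ g ∈ N, if (∀ y : X, g • y = y ↔ y = x) then 1 else 0 := by
    intro x
    rw [← Finset.card_filter, uCard, Nat.card_eq_fintype_card, Fintype.card_subtype]
    congr 1
    ext g; simp [N]
  simp_rw [h1, h2, ← Finset.sum_add_distrib]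
  rw [Finset.sum_comm]
  have h3 : ∀ g ∈ N, ∑ x ∈ S, ((if g • x = x then 1 else 0) +
      (if (∀ y : X, g • y = y ↔ y = x) then 1 else 0)) = 2 := by
    intro g hg
    have hg1 : g ≠ 1 := by simpa [N] using hg
    have hfix := hab g hg1
    have haS : a g ∈ S := (hS _).mpr ⟨g, hg1, (hfix _).mpr (Or.inl rfl)⟩
    have hbS : b g ∈ S := (hS _).mpr ⟨g, hg1, (hfix _).mpr (Or.inr rfl)⟩
    rw [Finset.sum_add_distrib, ← Finset.card_filter, ← Finset.card_filter]
    have e1 : S.filter (fun x => g • x = x) = {a g, b g} := by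
      ext x
      simp only [Finset.mem_filter, Finset.mem_insert, Finset.mem_singleton]
      rw [hfix]
      constructor
      · exact fun h => h.2
      · rintro (rfl | rfl)
        · exact ⟨haS, Or.inl rfl⟩
        · exact ⟨hbS, Or.inr rfl⟩
    rw [e1]
    by_cases hE : a g = b g
    · have e2 : S.filter (fun x => ∀ y : X, g • y = y ↔ y = x) = {a g} := by
        ext x
        simp only [Finset.mem_filter, Finset.mem_singleton]
        constructor
        · rintro ⟨-, h⟩
          exact ((h (a g)).mp ((hfix _).mpr (Or.inl rfl))).symm
        · rintro rfl
          refine ⟨haS, fun y => ?_⟩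
          rw [hfix, ← hE, or_self]
      rw [e2, ← hE]; simp
    · have e2 : S.filter (fun x => ∀ y : X, g • y = y ↔ y = x) = ∅ := by
        ext x
        simp only [Finset.mem_filter, Finset.notMem_empty, iff_false]
        rintro ⟨-, h⟩
        exact hE (((h (a g)).mp ((hfix _).mpr (Or.inl rfl))).trans
          ((h (b g)).mp ((hfix _).mpr (Or.inr rfl))).symm)
      rw [e2, Finset.card_pair hE]; simp
  rw [Finset.sum_congr rfl h3, Finset.sum_const, smul_eq_mul, mul_comm]
  congr 1
  simp [N, Nat.card_eq_fintype_card]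

theorem peel {G X : Type*} [Group G] [Finite G] [MulAction G X] (S : Finset X)
    (hS : ∀ (g : G), ∀ x ∈ S, g • x ∈ S) (f : X → ℕ) (hf : ∀ (g : G) x, f (g • x) = f x)
    (x : X) (hx : x ∈ S) : ∃ S' : Finset X, S' ⊆ S ∧ (∀ (g : G), ∀ x ∈ S', g • x ∈ S') ∧
      ∑ y ∈ S, f y = Nat.card (MulAction.orbit G x) * f x + ∑ y ∈ S', f y := by
  classical
  refine ⟨S.filter (fun y => y ∉ MulAction.orbit G x), Finset.filter_subset _ _, ?_, ?_⟩
  · intro g y hy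
    rw [Finset.mem_filter] at hy ⊢
    refine ⟨hS g y hy.1, fun h => hy.2 ?_⟩
    obtain ⟨k, hk⟩ := h
    exact ⟨g⁻¹ * k, by
      have hk' : k • x = g • y := hk
      change (g⁻¹ * k) • x = y
      rw [mul_smul, hk', inv_smul_smul]⟩
  · rw [← Finset.sum_filter_add_sum_filter_not S (fun y => y ∈ MulAction.orbit G x)]
    congr 1
    have h1 : ∀ y ∈ S.filter (fun y => y ∈ MulAction.orbit G x), f y = f x := by
      intro y hy
      obtain ⟨g, rfl⟩ := (Finset.mem_filter.mp hy).2
      exact hf g x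
    rw [Finset.sum_congr rfl h1, Finset.sum_const, smul_eq_mul]
    congr 1
    rw [Nat.card_coe_set_eq, ← Set.ncard_coe_finset]
    congr 1
    ext y
    simp only [Finset.coe_filter, Set.mem_ofPred_eq]
    constructor
    · exact fun h => h.2
    · rintro ⟨g, rfl⟩
      exact ⟨hS g x hx, g, rfl⟩

/-- The numerical core of the classification. -/
theorem numeric_core {G X : Type*} [Group G] [Finite G] [MulAction G X] [Nonempty X]
    (hF : ∀ g : G, g ≠ 1 → ∃ a b : X, ∀ x, g • x = x ↔ x = a ∨ x = b)
    (ho : ∀ x : X, 3 ≤ Nat.card (MulAction.orbit G x))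
    (hdata : ∀ x : X, ∃ q e : ℕ, 0 < q ∧ 0 < e ∧ Nat.card (MulAction.stabilizer G x) = q * e ∧
      uCard G x + 1 = q ∧ (q = 1 ∨ e ∣ q - 1) ∧ q ∣ Nat.card (MulAction.orbit G x) - 1) :
    Nat.card G = 12 ∨ Nat.card G = 24 ∨ Nat.card G = 60 ∨
    ∃ x : X, ∃ q e : ℕ, 1 < q ∧ Nat.card (MulAction.stabilizer G x) = q * e ∧
      uCard G x + 1 = q ∧ Nat.card (MulAction.orbit G x) = q + 1 ∧ q - 1 ≤ 2 * e := by
  obtain ⟨S, hS, hsum⟩ := count_fixed hF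
  set f : X → ℕ := fun x => (Nat.card (MulAction.stabilizer G x) - 1) + uCard G x with hfdef
  obtain ⟨n, hn⟩ : ∃ n, n = Nat.card G := ⟨_, rfl⟩
  have hmul : ∀ x : X, Nat.card (MulAction.orbit G x) * Nat.card (MulAction.stabilizer G x) = n := by
    intro x
    rw [hn, ← Nat.card_prod]
    exact Nat.card_congr (MulAction.orbitProdStabilizerEquivGroup G x)
  have hfinv : ∀ (g : G) x, f (g • x) = f x := by
    intro g x
    simp only [hfdef, uCard_smul]
    congr 2
    exact Nat.card_congr (MulAction.stabilizerEquivStabilizer (a := x) (b := g • x) (g := g) rfl).symm.toEquiv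
  have hSinv : ∀ (g : G), ∀ x ∈ S, g • x ∈ S := by
    intro g x hx
    obtain ⟨h, h1, h2⟩ := (hS x).mp hx
    refine (hS _).mpr ⟨g * h * g⁻¹, ?_, ?_⟩
    · simpa using h1
    · simp [mul_smul, h2]
  -- data of a point of `S`: either tame or wild
  have hpt : ∀ x ∈ S, (∃ t e : ℕ, t = Nat.card (MulAction.orbit G x) ∧ 3 ≤ t ∧ 2 ≤ e ∧ t * e = n ∧
        Nat.card (MulAction.orbit G x) * f x + t = n) ∨
      (∃ t q e : ℕ, t = Nat.card (MulAction.orbit G x) ∧ 3 ≤ t ∧ 1 < q ∧ e ∣ q - 1 ∧ q ∣ t - 1 ∧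
        t * (q * e) = n ∧ Nat.card (MulAction.stabilizer G x) = q * e ∧
        uCard G x + 1 = q ∧ Nat.card (MulAction.orbit G x) * f x = n + t * (q - 2)) := by
    intro x hx
    obtain ⟨q, e, hq, he, hs, hu, hqe, hqt⟩ := hdata x
    have ht := hmul x
    have hst : 2 ≤ Nat.card (MulAction.stabilizer G x) := by
      obtain ⟨g, hg1, hg⟩ := (hS x).mp hx
      by_contra hcon
      have h1 : Nat.card (MulAction.stabilizer G x) = 1 := by
        have : 0 < Nat.card (MulAction.stabilizer G x) := Nat.card_pos
        omega
      rw [Subgroup.card_eq_one] at h1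
      have : g ∈ MulAction.stabilizer G x := hg
      rw [h1, Subgroup.mem_bot] at this
      exact hg1 this
    have h3 := ho x
    obtain ⟨t, htd⟩ : ∃ t, t = Nat.card (MulAction.orbit G x) := ⟨_, rfl⟩
    have hfx : f x = (q * e - 1) + (q - 1) := by
      simp only [hfdef, hs]; omega
    rw [hs] at ht hst
    rw [← htd] at ht h3 hqt
    obtain ⟨c, hc⟩ : ∃ c, q * e = c + 2 := ⟨q * e - 2, by omega⟩
    rcases eq_or_ne q 1 with rfl | hq1
    · left
      refine ⟨t, e, htd, h3, by omega, by rw [← ht]; ring, ?_⟩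
      rw [← htd, hfx, hc, ← ht, hc, show c + 2 - 1 + (1 - 1) = c + 1 by omega]
      ring
    · right
      refine ⟨t, q, e, htd, h3, by omega, hqe.resolve_left hq1, hqt, ht, hs, hu, ?_⟩
      rw [← htd, hfx, hc, ← ht, hc, show c + 2 - 1 + (q - 1) = c + 2 + (q - 2) by omega]
      ring
  rw [← hn] at hsum
  obtain ⟨x0⟩ : Nonempty X := inferInstance
  have hn3 : 3 ≤ n := by
    have h1 := ho x0
    have h2 := hmul x0
    have h4 : 0 < Nat.card (MulAction.stabilizer G x0) := Nat.card_pos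
    nlinarith
  rw [← hn]
  by_cases hw : ∃ x ∈ S, ∃ t q e : ℕ, t = Nat.card (MulAction.orbit G x) ∧ 3 ≤ t ∧ 1 < q ∧
        e ∣ q - 1 ∧ q ∣ t - 1 ∧
        t * (q * e) = n ∧ Nat.card (MulAction.stabilizer G x) = q * e ∧
        uCard G x + 1 = q ∧ Nat.card (MulAction.orbit G x) * f x = n + t * (q - 2)
  · obtain ⟨x, hxS, t, q, e, htd, ht3, hq1, heq, hqt, htn, hs, hu, hfx⟩ := hw
    obtain ⟨S1, hS1, hS1inv, hsum1⟩ := peel S hSinv f hfinv x hxS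
    rw [hsum, hfx] at hsum1
    have hkey : q - 2 + 2 = q := by omega
    rcases S1.eq_empty_or_nonempty with rfl | ⟨y, hy⟩
    · exfalso
      rw [Finset.sum_empty] at hsum1
      have h1 : n = t * (q - 2) + 2 := by omega
      have he0 : 0 < e := by
        rcases Nat.eq_zero_or_pos e with rfl | h
        · simp at htn; omega
        · exact h
      have h2 : t * q ≤ n := by
        rw [← htn]; exact Nat.mul_le_mul_left _ (Nat.le_mul_of_pos_right _ he0)
      rw [← hkey, mul_add] at h2
      omega
    · obtain ⟨S2, hS2, hS2inv, hsum2⟩ := peel S1 hS1inv f hfinv y hy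
      rcases hpt y (hS1 hy) with ⟨T, d, hTd, hT3, hd2, hTn, hfy⟩ |
        ⟨T, q', e', hTd, hT3, hq1', heq', hqt', htn', hs', hu', hfy⟩
      · have hT2 : 2 * T ≤ n := by rw [← hTn]; nlinarith
        rcases S2.eq_empty_or_nonempty with rfl | ⟨z, hz⟩
        · rw [Finset.sum_empty] at hsum2
          have hT : T = 2 + t * (q - 2) := by omega
          rcases arith_wild htn hq1 heq hqt ht3 hT hT3 hTn with h | h
          · exact Or.inr (Or.inr (Or.inl h))
          · exact Or.inr (Or.inr (Or.inr ⟨x, q, e, hq1, hs, hu, htd ▸ h.1, h.2⟩))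
        · exfalso
          obtain ⟨S3, hS3, hS3inv, hsum3⟩ := peel S2 hS2inv f hfinv z hz
          rcases hpt z (hS1 (hS2 hz)) with ⟨T', d', hTd', hT3', hd2', hTn', hfz⟩ |
            ⟨T', q', e', hTd', hT3', hq1', heq', hqt', htn', hs', hu', hfz⟩
          · have hT2 : 2 * T' ≤ n := by rw [← hTn']; nlinarith
            omega
          · omega
      · exfalso
        omega
  · have hpt' : ∀ x ∈ S, ∃ t e : ℕ, 3 ≤ t ∧ 2 ≤ e ∧ t * e = n ∧ 2 * t ≤ n ∧
        Nat.card (MulAction.orbit G x) * f x + t = n := by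
      intro x hx
      rcases hpt x hx with ⟨t, e, -, h2, h3, h4, h5⟩ | h
      · exact ⟨t, e, h2, h3, h4, by rw [← h4]; nlinarith, h5⟩
      · exact absurd ⟨x, hx, h⟩ hw
    rcases S.eq_empty_or_nonempty with rfl | ⟨x1, hx1⟩
    · rw [Finset.sum_empty] at hsum; omega
    obtain ⟨S1, hS1, hS1inv, hsum1⟩ := peel S hSinv f hfinv x1 hx1
    rw [hsum] at hsum1
    obtain ⟨t1, e1, a1, b1, c1, d1, k1⟩ := hpt' x1 hx1
    rcases S1.eq_empty_or_nonempty with rfl | ⟨x2, hx2⟩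
    · rw [Finset.sum_empty] at hsum1; omega
    obtain ⟨S2, hS2, hS2inv, hsum2⟩ := peel S1 hS1inv f hfinv x2 hx2
    obtain ⟨t2, e2, a2, b2, c2, d2, k2⟩ := hpt' x2 (hS1 hx2)
    rcases S2.eq_empty_or_nonempty with rfl | ⟨x3, hx3⟩
    · rw [Finset.sum_empty] at hsum2; omega
    obtain ⟨S3, hS3, hS3inv, hsum3⟩ := peel S2 hS2inv f hfinv x3 hx3
    obtain ⟨t3, e3, a3, b3, c3, d3, k3⟩ := hpt' x3 (hS1 (hS2 hx3))
    rcases S3.eq_empty_or_nonempty with rfl | ⟨x4, hx4⟩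
    · rw [Finset.sum_empty] at hsum3
      rcases arith_tame (show t1 + t2 + t3 = n + 2 by omega) c1 c2 c3 a1 a2 a3 b1 b2 b3 with
        h | h | h
      · exact Or.inl h
      · exact Or.inr (Or.inl h)
      · exact Or.inr (Or.inr (Or.inl h))
    exfalso
    obtain ⟨S4, hS4, hS4inv, hsum4⟩ := peel S3 hS3inv f hfinv x4 hx4
    obtain ⟨t4, e4, a4, b4, c4, d4, k4⟩ := hpt' x4 (hS1 (hS2 (hS3 hx4)))
    omega

open OnePoint in
/-- Möbius permutation attached to a matrix. -/
def mob (F : Type*) [Field F] [DecidableEq F] : GL (Fin 2) F →* Equiv.Perm (OnePoint F) :=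
  MulAction.toPermHom _ _

section Mobius
variable {F : Type*} [Field F] [DecidableEq F]

/-- invertible matrix from entries -/
noncomputable def gl2 (a b c d : F) (h : a * d - b * c ≠ 0) : GL (Fin 2) F :=
  Matrix.GeneralLinearGroup.mkOfDetNeZero !![a, b; c, d] (by rwa [Matrix.det_fin_two_of])

theorem gl2_smul_infty (a b c d : F) (h : a * d - b * c ≠ 0) :
    gl2 a b c d h • (OnePoint.infty : OnePoint F) =
      if c = 0 then OnePoint.infty else ((a / c : F) : OnePoint F) := by
  rw [OnePoint.smul_infty_eq_ite]; rfl

theorem gl2_smul_coe (a b c d : F) (h : a * d - b * c ≠ 0) (z : F) :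
    gl2 a b c d h • (z : OnePoint F) =
      if c * z + d = 0 then OnePoint.infty else (((a * z + b) / (c * z + d) : F) : OnePoint F) := by
  rw [OnePoint.smul_some_eq_ite]; rfl

theorem mob_apply (g : GL (Fin 2) F) (x : OnePoint F) : mob F g x = g • x := rfl

theorem trans3 (x y z : OnePoint F) (hxy : x ≠ y) (hxz : x ≠ z) (hyz : y ≠ z) :
    ∃ g : GL (Fin 2) F, g • (OnePoint.infty : OnePoint F) = x ∧
      g • ((0 : F) : OnePoint F) = y ∧ g • ((1 : F) : OnePoint F) = z := by
  induction x using OnePoint.rec with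
  | infty =>
    induction y using OnePoint.rec with
    | infty => exact absurd rfl hxy
    | coe y =>
      induction z using OnePoint.rec with
      | infty => exact absurd rfl hxz
      | coe z =>
        have hyz : z - y ≠ 0 := sub_ne_zero.mpr fun h => hyz (by rw [h])
        refine ⟨gl2 (z - y) y 0 1 (by simpa using hyz), ?_, ?_, ?_⟩
        · rw [gl2_smul_infty]; simp
        · rw [gl2_smul_coe]; simp
        · rw [gl2_smul_coe]; simp
  | coe x =>
    induction y using OnePoint.rec with
    | infty =>
      induction z using OnePoint.rec with
      | infty => exact absurd rfl hyz
      | coe z =>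
        have hxz : z - x ≠ 0 := sub_ne_zero.mpr fun h => hxz (by rw [h])
        refine ⟨gl2 x (z - x) 1 0 (by intro h; apply hxz; linear_combination -h), ?_, ?_, ?_⟩
        · rw [gl2_smul_infty]; simp
        · rw [gl2_smul_coe]; simp
        · rw [gl2_smul_coe]; simp
    | coe y =>
      have hxy : x - y ≠ 0 := sub_ne_zero.mpr fun h => hxy (by rw [h])
      induction z using OnePoint.rec with
      | infty =>
        refine ⟨gl2 x (-y) 1 (-1) (by
          intro h; apply hxy; linear_combination -h), ?_, ?_, ?_⟩
        · rw [gl2_smul_infty]; simp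
        · rw [gl2_smul_coe]; simp
        · rw [gl2_smul_coe]; simp
      | coe z =>
        have hxz : x - z ≠ 0 := sub_ne_zero.mpr fun h => hxz (by rw [h])
        have hyz : z - y ≠ 0 := sub_ne_zero.mpr fun h => hyz (by rw [h])
        refine ⟨gl2 (x * (z - y)) (y * (x - z)) (z - y) (x - z) (by
          have := mul_ne_zero (mul_ne_zero hxy hxz) hyz
          intro h; apply this; linear_combination h), ?_, ?_, ?_⟩
        · rw [gl2_smul_infty, if_neg hyz, mul_div_cancel_right₀ _ hyz]
        · rw [gl2_smul_coe]; simp [hxz]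
        · have h1 : (z - y) * 1 + (x - z) ≠ 0 := by
            intro h; apply hxy; linear_combination h
          rw [gl2_smul_coe, if_neg h1]
          congr 1
          rw [div_eq_iff h1]; ring

/-- A matrix fixing three points acts trivially. -/
theorem fix3_std (g : GL (Fin 2) F) (h1 : g • (OnePoint.infty : OnePoint F) = OnePoint.infty)
    (h2 : g • ((0 : F) : OnePoint F) = (0 : F)) (h3 : g • ((1 : F) : OnePoint F) = (1 : F)) :
    g 1 0 = 0 ∧ g 0 1 = 0 ∧ g 0 0 = g 1 1 := by
  have hc : g 1 0 = 0 := OnePoint.smul_infty_eq_self_iff.mp h1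
  have hd : g 1 1 ≠ 0 := by
    intro h
    apply g.det_ne_zero
    rw [Matrix.det_fin_two, hc, h]; ring
  rw [OnePoint.smul_some_eq_ite, hc] at h2 h3
  simp only [zero_add, hd, if_false, mul_zero, mul_one, OnePoint.coe_eq_coe] at h2 h3
  have hb : g 0 1 = 0 := by
    rcases div_eq_zero_iff.mp h2 with h | h
    · exact h
    · exact absurd h hd
  rw [div_eq_one_iff_eq hd, hb, add_zero] at h3
  exact ⟨hc, hb, h3⟩

theorem smul_of_scalar (g : GL (Fin 2) F) (h : g 1 0 = 0 ∧ g 0 1 = 0 ∧ g 0 0 = g 1 1)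
    (x : OnePoint F) : g • x = x := by
  obtain ⟨hc, hb, ha⟩ := h
  have hd : g 1 1 ≠ 0 := by
    intro h
    apply g.det_ne_zero
    rw [Matrix.det_fin_two, hc, h]; ring
  induction x using OnePoint.rec with
  | infty => exact OnePoint.smul_infty_eq_self_iff.mpr hc
  | coe x =>
    rw [OnePoint.smul_some_eq_ite, hc, hb, ha]
    simp [hd]

theorem mob_fix3 (g : GL (Fin 2) F) (x y z : OnePoint F) (hxy : x ≠ y) (hxz : x ≠ z) (hyz : y ≠ z)
    (h1 : g • x = x) (h2 : g • y = y) (h3 : g • z = z) : mob F g = 1 := by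
  obtain ⟨t, tx, ty, tz⟩ := trans3 x y z hxy hxz hyz
  have key : ∀ w : OnePoint F, (t⁻¹ * g * t) • w = w := by
    apply smul_of_scalar
    apply fix3_std
    · rw [mul_smul, mul_smul, tx, h1, ← tx, inv_smul_smul]
    · rw [mul_smul, mul_smul, ty, h2, ← ty, inv_smul_smul]
    · rw [mul_smul, mul_smul, tz, h3, ← tz, inv_smul_smul]
  ext w
  rw [mob_apply]
  have := key (t⁻¹ • w)
  rw [mul_smul, mul_smul, smul_inv_smul] at this
  exact MulAction.injective t⁻¹ this

theorem mob_ker : (mob F).ker = Subgroup.center (GL (Fin 2) F) := by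
  ext g
  rw [MonoidHom.mem_ker, Matrix.GeneralLinearGroup.center_eq_range_scalar]
  constructor
  · intro h
    have h' : ∀ x : OnePoint F, g • x = x := fun x => by rw [← mob_apply, h]; rfl
    obtain ⟨hc, hb, ha⟩ := fix3_std g (h' _) (h' _) (h' _)
    have hd : g 1 1 ≠ 0 := by
      intro h
      apply g.det_ne_zero
      rw [Matrix.det_fin_two, hc, h]; ring
    refine ⟨Units.mk0 _ hd, ?_⟩
    ext i j
    fin_cases i <;> fin_cases j <;> simp [hc, hb, ha]
  · rintro ⟨u, rfl⟩
    ext x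
    rw [mob_apply, smul_of_scalar]
    · rfl
    · simp

/-- Möbius permutations fixing infinity are affine. -/
theorem mob_affine {s : Equiv.Perm (OnePoint F)} (hs : s ∈ (mob F).range)
    (h : s OnePoint.infty = OnePoint.infty) :
    ∃ (a : Fˣ) (b : F), ∀ z : F, s z = ((a * z + b : F) : OnePoint F) := by
  obtain ⟨g, rfl⟩ := hs
  have hc : g 1 0 = 0 := OnePoint.smul_infty_eq_self_iff.mp h
  have hd : g 1 1 ≠ 0 := by
    intro h
    apply g.det_ne_zero
    rw [Matrix.det_fin_two, hc, h]; ring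
  have ha : g 0 0 ≠ 0 := by
    intro h
    apply g.det_ne_zero
    rw [Matrix.det_fin_two, hc, h]; ring
  refine ⟨Units.mk0 (g 0 0 / g 1 1) (div_ne_zero ha hd), g 0 1 / g 1 1, fun z => ?_⟩
  rw [mob_apply, OnePoint.smul_some_eq_ite, hc]
  simp only [zero_mul, zero_add, hd, if_false, Units.val_mk0]
  congr 1
  field_simp

theorem mob_exists_fixed [IsAlgClosed F] {s : Equiv.Perm (OnePoint F)} (hs : s ∈ (mob F).range) :
    ∃ x, s x = x := by
  obtain ⟨g, rfl⟩ := hs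
  by_cases hc : g 1 0 = 0
  · exact ⟨OnePoint.infty, OnePoint.smul_infty_eq_self_iff.mpr hc⟩
  · have hdeg : g.fixpointPolynomial.degree ≠ 0 := by
      have : g.fixpointPolynomial.degree = 2 := by
        have : g.fixpointPolynomial = Polynomial.C (g 1 0) * Polynomial.X ^ 2 +
          Polynomial.C (g 1 1 - g 0 0) * Polynomial.X + Polynomial.C (- g 0 1) := by
          simp [Matrix.GeneralLinearGroup.fixpointPolynomial]; ring
        rw [this, Polynomial.degree_quadratic hc]
      rw [this]; decide
    obtain ⟨x, hx⟩ := IsAlgClosed.exists_root _ hdeg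
    refine ⟨(x : F), ?_⟩
    rw [mob_apply, ← Matrix.GeneralLinearGroup.fixpointPolynomial_aeval_eq_zero_iff]
    rw [Polynomial.aeval_def, Polynomial.eval₂_eq_eval_map]
    simpa using hx

theorem mobr_fix3 {s : Equiv.Perm (OnePoint F)} (hs : s ∈ (mob F).range) (x y z : OnePoint F)
    (hxy : x ≠ y) (hxz : x ≠ z) (hyz : y ≠ z)
    (h1 : s x = x) (h2 : s y = y) (h3 : s z = z) : s = 1 := by
  obtain ⟨g, rfl⟩ := hs
  exact mob_fix3 g x y z hxy hxz hyz h1 h2 h3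

theorem exists_two_others (x : OnePoint F) : ∃ y z : OnePoint F, x ≠ y ∧ x ≠ z ∧ y ≠ z := by
  by_cases h1 : x = OnePoint.infty
  · exact ⟨(0 : F), (1 : F), by simp [h1], by simp [h1], by simp⟩
  by_cases h0 : x = (0 : F)
  · exact ⟨OnePoint.infty, (1 : F), h1, by simp [h0], by simp⟩
  · exact ⟨OnePoint.infty, (0 : F), h1, h0, by simp⟩

theorem exists_mob_to_infty (x : OnePoint F) : ∃ t ∈ (mob F).range, t x = OnePoint.infty := by
  obtain ⟨y, z, h1, h2, h3⟩ := exists_two_others x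
  obtain ⟨g, hg, -, -⟩ := trans3 x y z h1 h2 h3
  refine ⟨mob F g⁻¹, ⟨_, rfl⟩, ?_⟩
  rw [mob_apply, ← hg, inv_smul_smul]

end Mobius

/-- Affine coordinates on a point stabilizer. -/
structure AffData {k : Type*} [Field k] [DecidableEq k]
    (H : Subgroup (Equiv.Perm (OnePoint k))) (x : OnePoint k) where
  t : Equiv.Perm (OnePoint k)
  ht : t ∈ (mob k).range
  htx : t x = OnePoint.infty
  a : MulAction.stabilizer H x →* kˣ
  b : MulAction.stabilizer H x → k
  hab : ∀ (g : MulAction.stabilizer H x) (z : k), t ((g : H).1 (t.symm (z : k))) = (((a g : k) * z + b g : k) : OnePoint k)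

section Stab
variable {k : Type*} [Field k] [DecidableEq k] {H : Subgroup (Equiv.Perm (OnePoint k))}

theorem exists_affData_of (hH : H ≤ (mob k).range) (x : OnePoint k)
    (t : Equiv.Perm (OnePoint k)) (ht : t ∈ (mob k).range) (htx : t x = OnePoint.infty) :
    ∃ D : AffData H x, D.t = t := by
  have h1 : ∀ g : MulAction.stabilizer H x, ∃ (a : kˣ) (b : k),
      ∀ z : k, t ((g : H).1 (t.symm z)) = ((a * z + b : k) : OnePoint k) := by
    intro g
    have := mob_affine (F := k) (s := t * (g : H).1 * t⁻¹)
      (mul_mem (mul_mem ht (hH (g : H).2)) (inv_mem ht)) (by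
        have hg : (g : H).1 x = x := g.2
        have : t⁻¹ OnePoint.infty = x := by rw [← htx]; exact t.symm_apply_apply x
        rw [Equiv.Perm.mul_apply, Equiv.Perm.mul_apply, this, hg, htx])
    exact this
  choose a b hab using h1
  have hmul : ∀ g h, a (g * h) = a g * a h ∧ b (g * h) = a g * b h + b g := by
    intro g h
    have key : ∀ z : k, (a (g * h) : k) * z + b (g * h) = a g * (a h * z + b h) + b g := by
      intro z
      have h1 := hab (g * h) z
      have h2 : t (((g * h : MulAction.stabilizer H x) : H).1 (t.symm z)) =
          t ((g : H).1 (t.symm (t ((h : H).1 (t.symm z))))) := by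
        rw [Equiv.symm_apply_apply]; rfl
      rw [h2, hab h, hab g] at h1
      exact (OnePoint.coe_injective h1).symm
    have k0 := key 0
    have k1 := key 1
    constructor
    · ext; push_cast; linear_combination k1 - k0
    · linear_combination k0
  exact ⟨⟨t, ht, htx, MonoidHom.mk' a fun g h => (hmul g h).1, b, hab⟩, rfl⟩

theorem exists_affData (hH : H ≤ (mob k).range) (x : OnePoint k) : Nonempty (AffData H x) := by
  obtain ⟨t, ht, htx⟩ := exists_mob_to_infty x
  obtain ⟨D, -⟩ := exists_affData_of hH x t ht htx
  exact ⟨D⟩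

namespace AffData
variable {x : OnePoint k} (D : AffData H x)

theorem b_mul (g h : MulAction.stabilizer H x) : D.b (g * h) = D.a g * D.b h + D.b g := by
  have h1 := D.hab (g * h) 0
  have h2 : D.t (((g * h : MulAction.stabilizer H x) : H).1 (D.t.symm (0 : k))) =
      D.t ((g : H).1 (D.t.symm (D.t ((h : H).1 (D.t.symm (0 : k)))))) := by
    rw [Equiv.symm_apply_apply]; rfl
  rw [h2, D.hab h, D.hab g] at h1
  have := OnePoint.coe_injective h1
  linear_combination -this

theorem symm_infty : D.t.symm OnePoint.infty = x := by
  rw [← D.htx, Equiv.symm_apply_apply]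

theorem eq_x_or (y : OnePoint k) : y = x ∨ ∃ z : k, y = D.t.symm z := by
  by_cases h : D.t y = OnePoint.infty
  · left; rw [← D.symm_infty, ← h, Equiv.symm_apply_apply]
  · right
    obtain ⟨z, hz⟩ := OnePoint.ne_infty_iff_exists.mp h
    exact ⟨z, by rw [hz, Equiv.symm_apply_apply]⟩

theorem symm_ne (z : k) : D.t.symm z ≠ x := by
  intro h
  exact OnePoint.coe_ne_infty _ (D.t.symm.injective (h.trans D.symm_infty.symm))

theorem fix_iff (g : MulAction.stabilizer H x) (z : k) :
    (g : H) • D.t.symm z = D.t.symm z ↔ D.a g * z + D.b g = z := by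
  have h := D.hab g z
  refine Iff.trans ?_ OnePoint.coe_eq_coe
  rw [← h]
  exact Equiv.eq_symm_apply D.t

theorem eq_one (g : MulAction.stabilizer H x) (h1 : D.a g = 1) (h2 : D.b g = 0) : g = 1 := by
  apply Subtype.ext
  apply Subtype.ext
  ext y
  rcases D.eq_x_or y with rfl | ⟨z, rfl⟩
  · exact g.2
  · exact (D.fix_iff g z).mpr (by simp [h1, h2])

theorem b_one : D.b 1 = 0 := by
  have := D.b_mul 1 1
  simpa using this

theorem ker_iff (g : MulAction.stabilizer H x) :
    D.a g = 1 ↔ g = 1 ∨ ∀ y, (g : H) • y = y ↔ y = x := by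
  constructor
  · intro h
    by_cases h0 : D.b g = 0
    · exact Or.inl (D.eq_one g h h0)
    · right
      intro y
      rcases D.eq_x_or y with rfl | ⟨z, rfl⟩
      · exact ⟨fun _ => rfl, fun _ => g.2⟩
      · rw [D.fix_iff]
        simp [h, h0, D.symm_ne]
  · rintro (rfl | h)
    · exact map_one _
    · by_contra hne
      have h1 : (D.a g : k) - 1 ≠ 0 := fun h => hne (Units.ext (sub_eq_zero.mp h))
      have := (D.fix_iff g (-D.b g / (D.a g - 1))).mpr (by field_simp; ring)
      exact D.symm_ne _ ((h _).mp this)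

/-- translation part, on the kernel -/
def tr : D.a.ker →* Multiplicative k where
  toFun g := Multiplicative.ofAdd (D.b g)
  map_one' := by rw [Subgroup.coe_one, D.b_one]; rfl
  map_mul' g h := by
    rw [Subgroup.coe_mul, D.b_mul, g.2]
    simp [add_comm, ofAdd_add]

theorem tr_inj : Function.Injective D.tr := by
  rw [injective_iff_map_eq_one]
  intro g hg
  apply Subtype.ext
  exact D.eq_one g g.2 (by simpa [tr] using hg)

theorem ker_comm (g h : D.a.ker) : g * h = h * g := by
  apply D.tr_inj
  rw [map_mul, map_mul, mul_comm]

theorem ker_pow (p : ℕ) [CharP k p] (g : D.a.ker) : g ^ p = 1 := by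
  apply D.tr_inj
  rw [map_pow, map_one]
  rw [← ofAdd_toAdd (D.tr g), ← ofAdd_nsmul]
  simp

theorem uCard_eq [Finite H] : uCard H x + 1 = Nat.card D.a.ker := by
  have e : {g : H // g ≠ 1 ∧ ∀ y, g • y = y ↔ y = x} ≃ {g : D.a.ker // g ≠ 1} :=
    { toFun := fun g => ⟨⟨⟨g.1, (g.2.2 x).mpr rfl⟩,
        (D.ker_iff _).mpr (Or.inr g.2.2)⟩, fun h => g.2.1 (congrArg (fun u => u.1.1) h)⟩
      invFun := fun g => ⟨g.1.1.1, fun h => g.2 (Subtype.ext (Subtype.ext h)),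
        ((D.ker_iff _).mp g.1.2).resolve_left fun h => g.2 (Subtype.ext h)⟩
      left_inv := fun g => rfl
      right_inv := fun g => rfl }
  rw [uCard, Nat.card_congr e]
  classical
  have := Fintype.ofFinite D.a.ker
  rw [Nat.card_eq_fintype_card, Nat.card_eq_fintype_card, Fintype.card_subtype_compl,
    Fintype.card_subtype_eq, Nat.sub_add_cancel Fintype.card_pos]

theorem card_stab : Nat.card (MulAction.stabilizer H x) =
    Nat.card D.a.ker * Nat.card D.a.range := by
  rw [← Subgroup.card_mul_index D.a.ker, Subgroup.index_ker]

theorem range_cyclic [Finite H] : IsCyclic D.a.range := by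
  have : Finite D.a.range := Finite.of_surjective D.a.rangeRestrict D.a.rangeRestrict_surjective
  infer_instance

theorem coprime (p : ℕ) [Fact p.Prime] [CharP k p] [Finite H] :
    Nat.Coprime (Nat.card D.a.range) p := by
  have : Finite D.a.range := Finite.of_surjective D.a.rangeRestrict D.a.rangeRestrict_surjective
  rw [Nat.coprime_comm, Nat.Prime.coprime_iff_not_dvd Fact.out]
  intro h
  obtain ⟨u, hu⟩ := exists_prime_orderOf_dvd_card' p h
  have h1 : u ^ p = 1 := by rw [← hu, pow_orderOf_eq_one]
  have h2 : ((u : kˣ) : k) ^ p = 1 := by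
    have := congrArg (fun v : D.a.range => ((v : kˣ) : k)) h1
    simpa using this
  have h3 : (((u : kˣ) : k) - 1) ^ p = 0 := by
    rw [sub_pow_char, h2, one_pow, sub_self]
  have h4 : u = 1 := Subtype.ext (Units.ext (sub_eq_zero.mp (pow_eq_zero_iff (Fact.out : p.Prime).ne_zero |>.mp h3)))
  rw [h4, orderOf_one] at hu
  exact (Fact.out : p.Prime).one_lt.ne hu

/-- The set of translations. -/
def trans : AddSubgroup k := (D.tr.range).toAddSubgroup'

theorem mem_trans (c : k) : c ∈ D.trans ↔ ∃ g : MulAction.stabilizer H x, D.a g = 1 ∧ D.b g = c := by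
  constructor
  · rintro ⟨g, hg⟩
    exact ⟨g, g.2, hg⟩
  · rintro ⟨g, h1, h2⟩
    exact ⟨⟨g, h1⟩, h2⟩

theorem card_trans : Nat.card D.trans = Nat.card D.a.ker :=
  Nat.card_congr (Equiv.ofInjective _ D.tr_inj).symm

theorem mul_mem_trans (u : D.a.range) {c : k} (hc : c ∈ D.trans) : (u : kˣ) * c ∈ D.trans := by
  obtain ⟨_, h, rfl⟩ := u
  rw [mem_trans] at hc ⊢
  obtain ⟨g, h1, rfl⟩ := hc
  refine ⟨h * g * h⁻¹, by simp [h1], ?_⟩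
  have h2 : D.b (h * h⁻¹) = 0 := by rw [mul_inv_cancel, D.b_one]
  rw [D.b_mul] at h2
  rw [D.b_mul, D.b_mul, map_mul, h1, mul_one]
  linear_combination h2

theorem e_dvd [Finite H] : Nat.card D.a.range ∣ Nat.card D.a.ker - 1 := by
  have : Finite D.a.ker := inferInstance
  have hft : Finite D.trans := Nat.finite_of_card_ne_zero (by rw [D.card_trans]; exact Nat.card_pos.ne')
  have h := free_dvd (Γ := D.a.range) (X := k) ((D.trans : Set k) \ {0}) ?_ ?_
  · rw [Nat.card_coe_set_eq, Set.ncard_sdiff_singleton_of_mem D.trans.zero_mem,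
      ← Nat.card_coe_set_eq] at h
    rw [← D.card_trans]; exact h
  · rintro g c ⟨hc, h0⟩
    exact ⟨D.mul_mem_trans g hc, fun h => h0 (by
      have h' : ((g : kˣ) : k) * c = 0 := h
      simpa using h')⟩
  · rintro g c ⟨hc, h0⟩ h
    have h' : ((g : kˣ) : k) * c = c := h
    apply Subtype.ext
    apply Units.ext
    exact mul_right_cancel₀ h0 (h'.trans (one_mul c).symm)

theorem q_dvd [Finite H] : Nat.card D.a.ker ∣ Nat.card (MulAction.orbit H x) - 1 := by
  have hfo : Finite (MulAction.orbit H x) := Set.finite_range _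
  have h := free_dvd (Γ := D.a.ker) (X := OnePoint k) (MulAction.orbit H x \ {x}) ?_ ?_
  · rw [Nat.card_coe_set_eq, Set.ncard_sdiff_singleton_of_mem (MulAction.mem_orbit_self x),
      ← Nat.card_coe_set_eq] at h
    exact h
  · rintro g y ⟨hy, h0⟩
    refine ⟨?_, ?_⟩
    · obtain ⟨m, rfl⟩ := hy
      exact ⟨g.1.1 * m, mul_smul _ _ _⟩
    · intro h
      apply h0
      have h1 : (g.1.1 : H) • y = x := h
      have h2 : (g.1.1 : H) • x = x := g.1.2
      exact MulAction.injective (g.1.1 : H) (h1.trans h2.symm)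
  · rintro g y ⟨hy, h0⟩ h
    have h1 : (g.1.1 : H) • y = y := h
    rcases (D.ker_iff _).mp g.2 with h2 | h2
    · exact Subtype.ext h2
    · exact absurd ((h2 y).mp h1) h0

end AffData
end Stab

/-- The list of groups in the classification. -/
def Concl (p : ℕ) [Fact p.Prime] (H : Type*) [Group H] : Prop :=
    IsCyclic H ∨
    (∃ m : ℕ, 0 < m ∧ Nonempty (H ≃* DihedralGroup m)) ∨
    Nonempty (H ≃* alternatingGroup (Fin 4)) ∨
    Nonempty (H ≃* alternatingGroup (Fin 5)) ∨
    Nonempty (H ≃* Equiv.Perm (Fin 4)) ∨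
    (∃ (A : Subgroup H) (q : ℕ), A.Normal ∧ (∀ x y : A, x * y = y * x) ∧
      (∀ a : A, a ^ p = 1) ∧ 0 < q ∧ Nat.Coprime q p ∧
      ∃ φ : H →* Multiplicative (ZMod q), Function.Surjective φ ∧ φ.ker = A) ∨
    (∃ r : ℕ, 0 < r ∧
      Nonempty (H ≃* Matrix.ProjectiveSpecialLinearGroup (Fin 2) (GaloisField p r))) ∨
    (∃ r : ℕ, 0 < r ∧
      Nonempty (H ≃* (GL (Fin 2) (GaloisField p r) ⧸
        Subgroup.center (GL (Fin 2) (GaloisField p r)))))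

theorem Concl.congr {p : ℕ} [Fact p.Prime] {G H : Type*} [Group G] [Group H] (e : H ≃* G)
    (h : Concl p G) : Concl p H := by
  rcases h with h | ⟨m, hm, ⟨f⟩⟩ | ⟨⟨f⟩⟩ | ⟨⟨f⟩⟩ | ⟨⟨f⟩⟩ | ⟨A, q, hn, hc, hp, hq, hqp, φ, hs, hk⟩ |
    ⟨r, hr, ⟨f⟩⟩ | ⟨r, hr, ⟨f⟩⟩
  · left
    exact isCyclic_of_surjective e.symm e.symm.surjective
  · right; left; exact ⟨m, hm, ⟨e.trans f⟩⟩
  · right; right; left; exact ⟨e.trans f⟩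
  · right; right; right; left; exact ⟨e.trans f⟩
  · right; right; right; right; left; exact ⟨e.trans f⟩
  · right; right; right; right; right; left
    refine ⟨A.comap e.toMonoidHom, q, hn.comap _, ?_, ?_, hq, hqp, φ.comp e.toMonoidHom,
      hs.comp e.surjective, ?_⟩
    · rintro ⟨x, hx⟩ ⟨y, hy⟩
      apply Subtype.ext
      apply e.injective
      have := congrArg Subtype.val (hc ⟨e x, hx⟩ ⟨e y, hy⟩)
      change e (x * y) = e (y * x)
      rw [map_mul, map_mul]
      exact this
    · rintro ⟨x, hx⟩
      apply Subtype.ext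
      apply e.injective
      have := congrArg Subtype.val (hp ⟨e x, hx⟩)
      change e (x ^ p) = e 1
      rw [map_pow, map_one]
      exact this
    · rw [← hk]; rfl
  · right; right; right; right; right; right; left; exact ⟨r, hr, ⟨e.trans f⟩⟩
  · right; right; right; right; right; right; right; exact ⟨r, hr, ⟨e.trans f⟩⟩

section
variable {k : Type*} [Field k] [DecidableEq k] {H : Subgroup (Equiv.Perm (OnePoint k))}

theorem concl_of_fixed (p : ℕ) [Fact p.Prime] [CharP k p] [Finite H]
    (hH : H ≤ (mob k).range) (x : OnePoint k) (hx : ∀ g : H, g • x = x) : Concl p H := by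
  obtain ⟨D⟩ := exists_affData hH x
  let e : H ≃* MulAction.stabilizer H x :=
    { toFun := fun g => ⟨g, hx g⟩
      invFun := fun g => g.1
      left_inv := fun g => rfl
      right_inv := fun g => rfl
      map_mul' := fun g h => rfl }
  refine Concl.congr e ?_
  right; right; right; right; right; left
  have hcyc := D.range_cyclic
  have hfin : Finite D.a.range :=
    Finite.of_surjective D.a.rangeRestrict D.a.rangeRestrict_surjective
  refine ⟨D.a.ker, Nat.card D.a.range, inferInstance, D.ker_comm, D.ker_pow p, Nat.card_pos,
    D.coprime p, (zmodCyclicMulEquiv hcyc).symm.toMonoidHom.comp D.a.rangeRestrict,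
    (zmodCyclicMulEquiv hcyc).symm.surjective.comp D.a.rangeRestrict_surjective, ?_⟩
  ext g
  simp [MonoidHom.mem_ker]

theorem smul_sq_swap {x y : OnePoint k} {g : H} (h : g • x = y) (h' : g • y = x) :
    (g * g) • x = x := by rw [mul_smul, h, h']

theorem fix3 (hH : H ≤ (mob k).range) {g : H} {x y z : OnePoint k} (hxy : x ≠ y) (hxz : x ≠ z)
    (hyz : y ≠ z) (h1 : g • x = x) (h2 : g • y = y) (h3 : g • z = z) : g = 1 :=
  Subtype.ext (mobr_fix3 (hH g.2) x y z hxy hxz hyz h1 h2 h3)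

theorem concl_of_two [IsAlgClosed k] (p : ℕ) [Fact p.Prime] [CharP k p] [Finite H]
    (hH : H ≤ (mob k).range) (x : OnePoint k) (hx : Nat.card (MulAction.orbit H x) = 2) :
    Concl p H := by
  obtain ⟨D⟩ := exists_affData hH x
  right; left
  have hmem : x ∈ MulAction.orbit H x := MulAction.mem_orbit_self x
  rw [Nat.card_coe_set_eq, Set.ncard_eq_two] at hx
  obtain ⟨y, hxy, hO⟩ : ∃ y, x ≠ y ∧ MulAction.orbit H x = {x, y} := by
    obtain ⟨u, v, huv, hO⟩ := hx
    rw [hO] at hmem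
    rcases hmem with rfl | hm
    · exact ⟨v, huv, hO⟩
    · have : x = v := hm
      subst this
      exact ⟨u, huv.symm, by rw [hO, Set.pair_comm]⟩
  have himg : ∀ g : H, (g • x = x ∧ g • y = y) ∨ (g • x = y ∧ g • y = x) := by
    intro g
    have h1 : g • x ∈ ({x, y} : Set (OnePoint k)) := by rw [← hO]; exact ⟨g, rfl⟩
    have h2 : g • y ∈ ({x, y} : Set (OnePoint k)) := by
      have : y ∈ MulAction.orbit H x := by rw [hO]; simp
      obtain ⟨m, rfl⟩ := this
      rw [← hO]; exact ⟨g * m, mul_smul _ _ _⟩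
    have hne : g • x ≠ g • y := fun h => hxy (MulAction.injective g h)
    rcases h1 with h1 | h1 <;> rcases h2 with h2 | h2
    · exact absurd (h1.trans h2.symm) hne
    · exact Or.inl ⟨h1, h2⟩
    · exact Or.inr ⟨h1, h2⟩
    · exact absurd (Eq.trans h1 (Eq.symm h2)) hne
  have hcyc := D.range_cyclic
  have hinj : Function.Injective D.a := by
    rw [injective_iff_map_eq_one]
    intro g hg
    rcases (D.ker_iff g).mp hg with h | h
    · exact h
    · rcases himg g with h1 | h1
      · exact absurd ((h y).mp h1.2).symm hxy
      · exact absurd (Eq.trans (Eq.symm g.2) h1.1) hxy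
  apply dihedral_of_index_two (MulAction.stabilizer H x)
  · exact isCyclic_of_injective D.a.rangeRestrict (by
      intro a b h; exact hinj (congrArg Subtype.val h))
  · rw [MulAction.index_stabilizer, hO, Set.ncard_pair hxy]
  · intro g hg
    rcases himg g with h1 | h1
    · exact absurd h1.1 hg
    · obtain ⟨z, hz⟩ := mob_exists_fixed (hH g.2)
      have hz' : g • z = z := hz
      refine fix3 hH (x := x) (y := y) (z := z) hxy ?_ ?_ (smul_sq_swap h1.1 h1.2)
        (smul_sq_swap h1.2 h1.1) (by rw [mul_smul, hz', hz'])
      · rintro rfl; exact hxy (hz'.symm.trans h1.1)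
      · rintro rfl; exact hxy (h1.2.symm.trans hz')

theorem two_fixed [IsAlgClosed k] (hH : H ≤ (mob k).range) (g : H) (hg : g ≠ 1) :
    ∃ a b : OnePoint k, ∀ x, g • x = x ↔ x = a ∨ x = b := by
  obtain ⟨a, ha⟩ := mob_exists_fixed (hH g.2)
  have ha' : g • a = a := ha
  by_cases h : ∃ b, b ≠ a ∧ g • b = b
  · obtain ⟨b, hb, hgb⟩ := h
    refine ⟨a, b, fun x => ⟨fun hx => ?_, ?_⟩⟩
    · by_contra hc
      push Not at hc
      exact hg (fix3 hH hc.1 hc.2 hb.symm hx ha' hgb)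
    · rintro (rfl | rfl) <;> assumption
  · push Not at h
    refine ⟨a, a, fun x => ⟨fun hx => ?_, ?_⟩⟩
    · by_contra hc
      push Not at hc
      exact h x hc.1 hx
    · rintro (rfl | rfl) <;> assumption

theorem classify_of_wild [IsAlgClosed k] (p : ℕ) [Fact p.Prime] [CharP k p] [Finite H]
    (hH : H ≤ (mob k).range)
    (hwild : ∀ x : OnePoint k, ∀ q e : ℕ, 1 < q → Nat.card (MulAction.stabilizer H x) = q * e →
      uCard H x + 1 = q → Nat.card (MulAction.orbit H x) = q + 1 → q - 1 ≤ 2 * e → Concl p H) :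
    Concl p H := by
  have hfo : ∀ x : OnePoint k, Finite (MulAction.orbit H x) := fun x => Set.finite_range _
  have hpos : ∀ x : OnePoint k, 0 < Nat.card (MulAction.orbit H x) := fun x =>
    have := hfo x
    have : Nonempty (MulAction.orbit H x) := ⟨⟨x, MulAction.mem_orbit_self x⟩⟩
    Nat.card_pos
  by_cases h1 : ∃ x : OnePoint k, Nat.card (MulAction.orbit H x) = 1
  · obtain ⟨x, hx⟩ := h1
    apply concl_of_fixed p hH x
    intro g
    have := (Nat.card_eq_one_iff_unique.mp hx).1
    exact congrArg Subtype.val (this.elim ⟨g • x, g, rfl⟩ ⟨x, MulAction.mem_orbit_self x⟩)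
  by_cases h2 : ∃ x : OnePoint k, Nat.card (MulAction.orbit H x) = 2
  · obtain ⟨x, hx⟩ := h2
    exact concl_of_two p hH x hx
  have h3 : ∀ x : OnePoint k, 3 ≤ Nat.card (MulAction.orbit H x) := by
    intro x
    have a1 := hpos x
    have a2 : Nat.card (MulAction.orbit H x) ≠ 1 := fun h => h1 ⟨x, h⟩
    have a3 : Nat.card (MulAction.orbit H x) ≠ 2 := fun h => h2 ⟨x, h⟩
    omega
  have hN : NNC H := by
    apply NNC.of_action (X := OnePoint k)
    · intro g
      exact mob_exists_fixed (hH g.2)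
    · intro g x y z hxy hxz hyz a b c
      exact fix3 hH hxy hxz hyz a b c
    · intro x y
      by_contra hc
      push Not at hc
      have hsub : MulAction.orbit H x ⊆ {x, y} := by
        rintro _ ⟨g, rfl⟩
        by_cases h : g • x = x
        · exact Or.inl h
        · exact Or.inr (hc g h)
      have := Set.ncard_le_ncard hsub
      have h4 := Set.ncard_insert_le x {y}
      rw [Set.ncard_singleton] at h4
      have h5 := h3 x
      rw [Nat.card_coe_set_eq] at h5
      omega
  have hd : ∀ x : OnePoint k, ∃ q e : ℕ, 0 < q ∧ 0 < e ∧
      Nat.card (MulAction.stabilizer H x) = q * e ∧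
      uCard H x + 1 = q ∧ (q = 1 ∨ e ∣ q - 1) ∧ q ∣ Nat.card (MulAction.orbit H x) - 1 := by
    intro x
    obtain ⟨D⟩ := exists_affData hH x
    have hfin : Finite D.a.range :=
      Finite.of_surjective D.a.rangeRestrict D.a.rangeRestrict_surjective
    exact ⟨Nat.card D.a.ker, Nat.card D.a.range, Nat.card_pos, Nat.card_pos, D.card_stab,
      D.uCard_eq, Or.inr D.e_dvd, D.q_dvd⟩
  rcases numeric_core (two_fixed hH) h3 hd with h | h | h | ⟨x, q, e, a1, a2, a3, a4, a5⟩
  · right; right; left; exact hN.card12 h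
  · right; right; right; right; left; exact hN.card24 h
  · right; right; right; left; exact hN.card60 h
  · exact hwild x q e a1 a2 a3 a4 a5
end

theorem subfield_of_mult {k : Type*} [Field k] (p : ℕ) [Fact p.Prime] [CharP k p]
    (A : AddSubgroup k) [Finite A] (h1 : (1 : k) ∈ A) (M : Subgroup kˣ)
    (hM : ∀ u ∈ M, ∀ a ∈ A, (u : k) * a ∈ A) (hc : Nat.card A ≤ 2 * Nat.card M + 1) :
    ∃ r : ℕ, 0 < r ∧ ∃ i : GaloisField p r →+* k, ∀ c, c ∈ A ↔ ∃ u, i u = c := by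
  classical
  let K : AddSubgroup k :=
    { carrier := {c | ∀ a ∈ A, c * a ∈ A}
      zero_mem' := fun a _ => by rw [zero_mul]; exact A.zero_mem
      add_mem' := fun {x y} hx hy a ha => by rw [add_mul]; exact A.add_mem (hx a ha) (hy a ha)
      neg_mem' := fun {x} hx a ha => by rw [neg_mul]; exact A.neg_mem (hx a ha) }
  have hKA : K ≤ A := fun c hc => by simpa using hc 1 h1
  have hKfin : Finite K := Finite.of_injective _ (AddSubgroup.inclusion_injective hKA)
  have hdvd : Nat.card K ∣ Nat.card A := AddSubgroup.card_dvd_of_le hKA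
  have hle : Nat.card M + 1 ≤ Nat.card K := by
    have hinj : Function.Injective (fun o : Option M => match o with
        | none => (0 : K)
        | some u => (⟨(u : kˣ), hM u u.2⟩ : K)) := by
      rintro (_ | u) (_ | v) h
      · rfl
      · exact absurd (congrArg Subtype.val h).symm (v : kˣ).ne_zero
      · exact absurd (congrArg Subtype.val h) (u : kˣ).ne_zero
      · rw [Subtype.ext (Units.ext (congrArg Subtype.val h))]
    have := Nat.card_le_card_of_injective _ hinj
    have hMf : Finite M := by
      have := Finite.of_injective _ hinj
      exact Finite.of_injective (some : M → Option M) (Option.some_injective _)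
    rwa [Finite.card_option] at this
  have hcard : Nat.card K = Nat.card A := by
    obtain ⟨m, hm⟩ := hdvd
    have hpos : 0 < Nat.card A := Nat.card_pos
    have : m = 1 := by
      rcases m with _ | _ | m
      · omega
      · rfl
      · exfalso
        nlinarith
    rw [hm, this, mul_one]
  have hKeq : K = A := AddSubgroup.eq_of_le_of_card_ge hKA hcard.ge
  have hmul : ∀ a ∈ A, ∀ b ∈ A, a * b ∈ A := by
    intro a ha b hb
    rw [← hKeq] at ha
    exact ha b hb
  let L : Subfield k :=
    { carrier := A
      zero_mem' := A.zero_mem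
      one_mem' := h1
      add_mem' := A.add_mem
      mul_mem' := fun {a b} ha hb => hmul a ha b hb
      neg_mem' := A.neg_mem
      inv_mem' := by
        intro c hc
        by_cases h0 : c = 0
        · subst h0; rw [_root_.inv_zero]; exact A.zero_mem
        · have hinj : Function.Injective (fun a : A => (⟨c * a, hmul c hc a a.2⟩ : A)) := by
            intro a b h
            exact Subtype.ext (mul_left_cancel₀ h0 (congrArg Subtype.val h))
          obtain ⟨a, ha⟩ := (Finite.injective_iff_surjective.mp hinj) ⟨1, h1⟩
          have : c * a = 1 := congrArg Subtype.val ha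
          rw [inv_eq_of_mul_eq_one_right this]
          exact a.2 }
  have hLf : Finite L := ‹Finite A›
  have := Fintype.ofFinite L
  have hch : CharP L p := inferInstance
  obtain ⟨n, hp, hn⟩ := FiniteField.card L p
  have := Fintype.ofFinite (GaloisField p n)
  refine ⟨n, n.pos, L.subtype.comp (FiniteField.ringEquivOfCardEq (K := GaloisField p n) (K' := L) ?_ : _ ≃+* _).toRingHom, ?_⟩
  · rw [hn, ← Nat.card_eq_fintype_card, GaloisField.card p n n.pos.ne']
  · intro c
    constructor
    · intro hc
      obtain ⟨u, hu⟩ := (FiniteField.ringEquivOfCardEq (K := GaloisField p n) (K' := L) (by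
        rw [hn, ← Nat.card_eq_fintype_card, GaloisField.card p n n.pos.ne'])).surjective ⟨c, hc⟩
      exact ⟨u, congrArg Subtype.val hu⟩
    · rintro ⟨u, rfl⟩
      exact Subtype.prop (p := fun c => c ∈ L) _

section SL
variable {F : Type*} [Field F]

theorem mul_isSquare [Finite F] {a b : F} (ha : ¬ IsSquare a) (hb : ¬ IsSquare b) :
    IsSquare (a * b) := by
  classical
  have := Fintype.ofFinite F
  have h0 : a * b ≠ 0 := by
    intro h
    rcases mul_eq_zero.mp h with rfl | rfl
    · exact ha IsSquare.zero
    · exact hb IsSquare.zero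
  by_cases hF : ringChar F = 2
  · exact FiniteField.isSquare_of_char_two hF _
  rw [← quadraticChar_one_iff_isSquare h0, map_mul,
    (quadraticChar_neg_one_iff_not_isSquare).mpr ha,
    (quadraticChar_neg_one_iff_not_isSquare).mpr hb]
  rfl

theorem gl2_val (a b c d : F) (h : a * d - b * c ≠ 0) :
    (gl2 a b c d h).1 = !![a, b; c, d] := rfl

theorem toGL_mem (S : Subgroup (GL (Fin 2) F))
    (hU : ∀ u : F, gl2 1 u 0 1 (by simp) ∈ S) (hL : ∀ u : F, gl2 1 0 u 1 (by simp) ∈ S)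
    (g : SpecialLinearGroup (Fin 2) F) : SpecialLinearGroup.toGL g ∈ S := by
  have key : ∀ g : GL (Fin 2) F, g.1.det = 1 → g 1 0 ≠ 0 → g ∈ S := by
    intro g hdet hc
    have : g = gl2 1 ((g 0 0 - 1) / g 1 0) 0 1 (by simp) * gl2 1 0 (g 1 0) 1 (by simp) *
        gl2 1 ((g 1 1 - 1) / g 1 0) 0 1 (by simp) := by
      apply Units.ext
      rw [Units.val_mul, Units.val_mul, gl2_val, gl2_val, gl2_val]
      rw [Matrix.det_fin_two] at hdet
      ext i j
      fin_cases i <;> fin_cases j <;> simp [Matrix.mul_apply, Fin.sum_univ_two] <;> field_simp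
      · ring
      · linear_combination -hdet
      · ring
    rw [this]
    exact S.mul_mem (S.mul_mem (hU _) (hL _)) (hU _)
  have hdet : (SpecialLinearGroup.toGL g).1.det = 1 := g.2
  by_cases hc : (SpecialLinearGroup.toGL g) 1 0 = 0
  · have h1 : gl2 1 0 1 1 (by simp) * SpecialLinearGroup.toGL g ∈ S := by
      apply key
      · rw [Units.val_mul, Matrix.det_mul, hdet, gl2_val]; simp
      · have ha : (SpecialLinearGroup.toGL g) 0 0 ≠ 0 := by
          intro ha
          rw [Matrix.det_fin_two, ha, hc] at hdet
          simp at hdet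
        rw [Units.val_mul, gl2_val]
        simp only [Matrix.mul_apply, Fin.sum_univ_two]
        rw [hc]
        simpa using ha
    exact (S.mul_mem_cancel_left (hL 1)).mp h1
  · exact key _ hdet hc

theorem lower_mem (S : Subgroup (GL (Fin 2) F))
    (hU : ∀ u : F, gl2 1 u 0 1 (by simp) ∈ S) (g : GL (Fin 2) F) (hg : g ∈ S) (h0 : g 0 0 = 0)
    (u : F) : gl2 1 0 u 1 (by simp) ∈ S := by
  have hb : g 0 1 ≠ 0 ∧ g 1 0 ≠ 0 := by
    constructor <;>
    · intro h
      apply g.det_ne_zero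
      rw [Matrix.det_fin_two, h0, h]; ring
  have : gl2 1 0 u 1 (by simp) * g = g * gl2 1 (u * g 0 1 / g 1 0) 0 1 (by simp) := by
    apply Units.ext
    rw [Units.val_mul, Units.val_mul, gl2_val, gl2_val]
    ext i j
    obtain ⟨hb, hc⟩ := hb
    fin_cases i <;> fin_cases j <;> simp [Matrix.mul_apply, Fin.sum_univ_two, h0] <;> field_simp
  exact (S.mul_mem_cancel_right hg).mp (this ▸ S.mul_mem hg (hU _))

theorem det_square_decomp (g : GL (Fin 2) F) (h : IsSquare g.1.det) :
    ∃ (u : Fˣ) (s : SpecialLinearGroup (Fin 2) F),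
      g = GeneralLinearGroup.scalar (Fin 2) u * SpecialLinearGroup.toGL s := by
  obtain ⟨c, hc⟩ := h
  have hc0 : c ≠ 0 := by
    rintro rfl
    exact g.det_ne_zero (by simpa using hc)
  refine ⟨Units.mk0 c hc0, ⟨c⁻¹ • g.1, ?_⟩, ?_⟩
  · rw [Matrix.det_smul, hc]
    simp
    field_simp
  · apply Units.ext
    rw [Units.val_mul]
    ext i j
    change _ = ((Matrix.scalar (Fin 2) c) * (c⁻¹ • g.1)) i j
    rw [Matrix.scalar_apply, Matrix.diagonal_mul, Matrix.smul_apply, smul_eq_mul,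
      mul_inv_cancel_left₀ hc0]
end SL

theorem wild_iso {F k : Type*} [Field F] [Finite F] [DecidableEq F] [Field k] [DecidableEq k]
    (i : F →+* k) (H : Subgroup (Equiv.Perm (OnePoint k))) (hH : H ≤ (mob k).range)
    (hU : ∀ u : F, mob k (gl2 1 (i u) 0 1 (by simp)) ∈ H)
    (hst : ∀ s ∈ H, ∀ y : OnePoint F, ∃ z : OnePoint F, s (OnePoint.map i y) = OnePoint.map i z)
    (h0 : ∃ s ∈ H, s OnePoint.infty = ((0 : k) : OnePoint k)) :
    Nonempty (H ≃* Matrix.ProjectiveSpecialLinearGroup (Fin 2) F) ∨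
    Nonempty (H ≃* (GL (Fin 2) F ⧸ Subgroup.center (GL (Fin 2) F))) := by
  have hiinj : Function.Injective (OnePoint.map i) := Option.map_injective i.injective
  let θ : GL (Fin 2) F →* Equiv.Perm (OnePoint k) := (mob k).comp (GeneralLinearGroup.map i)
  have hθ : ∀ g y, θ g (OnePoint.map i y) = OnePoint.map i (g • y) := fun g y =>
    (OnePoint.map_smul i g y).symm
  have hker : θ.ker = Subgroup.center (GL (Fin 2) F) := by
    rw [← mob_ker]
    ext g
    rw [MonoidHom.mem_ker, MonoidHom.mem_ker]
    constructor
    · intro h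
      ext y
      apply hiinj
      change OnePoint.map i (g • y) = OnePoint.map i y
      rw [← hθ, h]; rfl
    · intro h
      have h' : ∀ x : OnePoint F, g • x = x := fun x => by rw [← mob_apply, h]; rfl
      obtain ⟨hc, hb, ha⟩ := fix3_std g (h' _) (h' _) (h' _)
      ext x
      refine smul_of_scalar _ ⟨?_, ?_, ?_⟩ x
      · simp [hc]
      · simp [hb]
      · simp [ha]
  have hrange : H ≤ θ.range := by
    intro s hs
    obtain ⟨x, hx⟩ := hst s hs OnePoint.infty
    obtain ⟨y, hy⟩ := hst s hs (0 : F)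
    obtain ⟨z, hz⟩ := hst s hs (1 : F)
    have inj : Function.Injective (fun w => s (OnePoint.map i w)) := s.injective.comp hiinj
    obtain ⟨g, g1, g2, g3⟩ := trans3 x y z
      (by rintro rfl; exact OnePoint.infty_ne_coe _ (inj (hx.trans hy.symm)))
      (by rintro rfl; exact OnePoint.infty_ne_coe _ (inj (hx.trans hz.symm)))
      (by rintro rfl; simpa using (inj (hy.trans hz.symm)))
    refine ⟨g, ?_⟩
    have key : (θ g)⁻¹ * s = 1 := by
      refine mobr_fix3 (F := k) (mul_mem (inv_mem ⟨_, rfl⟩) (hH hs))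
        (OnePoint.map i OnePoint.infty) (OnePoint.map i (0 : F)) (OnePoint.map i (1 : F))
        (hiinj.ne (by simp)) (hiinj.ne (by simp)) (hiinj.ne (by simp)) ?_ ?_ ?_
      · rw [Equiv.Perm.mul_apply, hx, ← g1, ← hθ]; exact Equiv.symm_apply_apply _ _
      · rw [Equiv.Perm.mul_apply, hy, ← g2, ← hθ]; exact Equiv.symm_apply_apply _ _
      · rw [Equiv.Perm.mul_apply, hz, ← g3, ← hθ]; exact Equiv.symm_apply_apply _ _
    exact inv_mul_eq_one.mp key
  let S : Subgroup (GL (Fin 2) F) := H.comap θ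
  have hSU : ∀ u : F, gl2 1 u 0 1 (by simp) ∈ S := by
    intro u
    have e : GeneralLinearGroup.map i (gl2 1 u 0 1 (by simp)) = gl2 1 (i u) 0 1 (by simp) := by
      apply Units.ext
      ext a b
      fin_cases a <;> fin_cases b <;> simp [gl2_val]
    change mob k (GeneralLinearGroup.map i (gl2 1 u 0 1 _)) ∈ H
    rw [e]; exact hU u
  have hSL : ∀ u : F, gl2 1 0 u 1 (by simp) ∈ S := by
    obtain ⟨s, hs, hs0⟩ := h0
    obtain ⟨g, rfl⟩ := hrange hs
    refine lower_mem S hSU g hs ?_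
    have h1 : OnePoint.map i (g • (OnePoint.infty : OnePoint F)) = OnePoint.map i (0 : F) := by
      rw [← hθ]
      change θ g OnePoint.infty = ((i 0 : k) : OnePoint k)
      rw [hs0, map_zero]
    have h2 := hiinj h1
    rw [OnePoint.smul_infty_eq_ite] at h2
    split_ifs at h2 with hc
    · exact absurd h2 (OnePoint.infty_ne_coe _)
    · have := OnePoint.coe_injective h2
      exact (div_eq_zero_iff.mp this).resolve_right hc
  have hSS := toGL_mem S hSU hSL
  have hscalar : ∀ u : Fˣ, θ (GeneralLinearGroup.scalar (Fin 2) u) = 1 := by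
    intro u
    rw [← MonoidHom.mem_ker, hker, GeneralLinearGroup.center_eq_range_scalar]
    exact ⟨u, rfl⟩
  have hsq : ∀ g : GL (Fin 2) F, IsSquare g.1.det → g ∈ S := by
    intro g hg
    obtain ⟨u, s, rfl⟩ := det_square_decomp g hg
    refine S.mul_mem ?_ (hSS s)
    change θ _ ∈ H
    rw [hscalar]; exact H.one_mem
  by_cases hns : ∃ g ∈ S, ¬ IsSquare g.1.det
  · right
    obtain ⟨g, hgS, hg⟩ := hns
    have htop : ∀ h, h ∈ S := by
      intro h
      by_cases hh : IsSquare h.1.det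
      · exact hsq h hh
      · refine (S.mul_mem_cancel_left hgS).mp (hsq _ ?_)
        rw [Units.val_mul, Matrix.det_mul]
        exact mul_isSquare hg hh
    have hEq : H = θ.range := by
      apply le_antisymm hrange
      rintro _ ⟨h, rfl⟩
      exact htop h
    exact ⟨((MulEquiv.subgroupCongr hEq).trans
      (QuotientGroup.quotientKerEquivRange θ).symm).trans
        (QuotientGroup.quotientMulEquivOfEq hker)⟩
  · left
    push Not at hns
    let ψ := θ.comp (SpecialLinearGroup.toGL (n := Fin 2) (R := F))
    have hEq : H = ψ.range := by
      apply le_antisymm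
      · intro s hs
        obtain ⟨g, rfl⟩ := hrange hs
        obtain ⟨u, s, rfl⟩ := det_square_decomp g (hns g hs)
        exact ⟨s, by rw [map_mul, hscalar, one_mul]; rfl⟩
      · rintro _ ⟨s, rfl⟩
        exact hSS s
    have hk : ψ.ker = Subgroup.center (SpecialLinearGroup (Fin 2) F) := by
      ext s
      rw [← SpecialLinearGroup.toGL_mem_center_iff, ← hker]
      rfl
    exact ⟨((MulEquiv.subgroupCongr hEq).trans
      (QuotientGroup.quotientKerEquivRange ψ).symm).trans
        (QuotientGroup.quotientMulEquivOfEq hk)⟩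

theorem concl_of_wild {k : Type*} [Field k] [DecidableEq k]
    {H : Subgroup (Equiv.Perm (OnePoint k))} (p : ℕ) [Fact p.Prime] [CharP k p] [Finite H]
    (hH : H ≤ (mob k).range) (x : OnePoint k) (q e : ℕ) (hq1 : 1 < q)
    (hst : Nat.card (MulAction.stabilizer H x) = q * e) (hu : uCard H x + 1 = q)
    (horb : Nat.card (MulAction.orbit H x) = q + 1) (hqe : q - 1 ≤ 2 * e) : Concl p H := by
  classical
  have hfo : Finite (MulAction.orbit H x) := Set.finite_range _
  -- a nontrivial unipotent element
  obtain ⟨u, hu1, hux⟩ : ∃ u : H, u ≠ 1 ∧ ∀ y : OnePoint k, u • y = y ↔ y = x := by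
    have : Nonempty {g : H // g ≠ 1 ∧ ∀ y : OnePoint k, g • y = y ↔ y = x} := by
      by_contra hne
      rw [not_nonempty_iff] at hne
      have : uCard H x = 0 := Nat.card_of_isEmpty
      omega
    obtain ⟨⟨u, h⟩⟩ := this
    exact ⟨u, h⟩
  obtain ⟨y, hyO, hyx⟩ : ∃ y ∈ MulAction.orbit H x, y ≠ x := by
    rw [Nat.card_coe_set_eq] at horb
    exact Set.exists_ne_of_one_lt_ncard (by omega) x
  have hux' : u • x = x := (hux x).mpr rfl
  have hwx : x ≠ u • y := fun h => hyx (MulAction.injective u (h.symm.trans hux'.symm))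
  have hwy : y ≠ u • y := fun h => hyx ((hux y).mp h.symm)
  obtain ⟨g, g1, g2, g3⟩ := trans3 x y (u • y) hyx.symm hwx hwy
  obtain ⟨D, hDt⟩ := exists_affData_of hH x (mob k g⁻¹) ⟨_, rfl⟩ (by
    rw [mob_apply, ← g1, inv_smul_smul])
  have ty : D.t y = ((0 : k) : OnePoint k) := by rw [hDt, mob_apply, ← g2, inv_smul_smul]
  have tw : D.t (u • y) = ((1 : k) : OnePoint k) := by rw [hDt, mob_apply, ← g3, inv_smul_smul]
  have ty' : D.t.symm ((0 : k) : OnePoint k) = y := by rw [← ty, Equiv.symm_apply_apply]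
  have hker : Nat.card D.a.ker = q := by rw [← D.uCard_eq, hu]
  have hran : Nat.card D.a.range = e := by
    have := D.card_stab
    rw [hst, hker] at this
    exact (Nat.eq_of_mul_eq_mul_left (by omega) this).symm
  have h1 : (1 : k) ∈ D.trans := by
    rw [D.mem_trans]
    have ha : D.a ⟨u, hux'⟩ = 1 := (D.ker_iff _).mpr (Or.inr hux)
    refine ⟨⟨u, hux'⟩, ha, ?_⟩
    have h := D.hab ⟨u, hux'⟩ 0
    rw [ty'] at h
    have h' := tw.symm.trans h
    simpa using (OnePoint.coe_injective h').symm
  have hft : Finite D.trans := Nat.finite_of_card_ne_zero (by rw [D.card_trans, hker]; omega)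
  obtain ⟨r, hr, i, hi⟩ := subfield_of_mult p D.trans h1 D.a.range
    (fun v hv a ha => D.mul_mem_trans ⟨v, hv⟩ ha) (by rw [D.card_trans, hker, hran]; omega)
  -- the orbit
  have hT : insert x ((fun c : k => D.t.symm (c : OnePoint k)) '' (D.trans : Set k)) =
      MulAction.orbit H x := by
    refine Set.eq_of_subset_of_ncard_le ?_ ?_ (Set.finite_range _)
    · apply Set.insert_subset (MulAction.mem_orbit_self x)
      rintro _ ⟨c, hc, rfl⟩
      obtain ⟨m, hm, rfl⟩ := (D.mem_trans c).mp hc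
      obtain ⟨v, rfl⟩ := hyO
      refine ⟨m.1 * v, ?_⟩
      have h := D.hab m 0
      rw [ty', mul_zero, zero_add] at h
      change (m.1 * v) • x = D.t.symm (D.b m)
      rw [mul_smul, ← h, Equiv.symm_apply_apply]
      rfl
    · rw [← Nat.card_coe_set_eq, horb, Set.ncard_insert_of_notMem, Set.ncard_image_of_injective,
        ← Nat.card_coe_set_eq]
      · exact (by rw [← hker, ← D.card_trans]; rfl : q + 1 = _ + 1).le
      · intro a b h
        exact OnePoint.coe_injective (D.t.symm.injective h)
      · rintro ⟨c, -, h⟩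
        exact D.symm_ne c h
  let φ := (MulAut.conj D.t).toMonoidHom
  refine Concl.congr (H.equivMapOfInjective φ (MulAut.conj D.t).injective) ?_
  have hφ : ∀ (m : H) z, φ m z = D.t (m.1 (D.t.symm z)) := fun m z => rfl
  have hw := wild_iso i (H.map φ) ?_ ?_ ?_ ?_
  · rcases hw with h | h
    · right; right; right; right; right; right; left; exact ⟨r, hr, h⟩
    · right; right; right; right; right; right; right; exact ⟨r, hr, h⟩
  · rintro _ ⟨m, hm, rfl⟩
    exact mul_mem (mul_mem D.ht (hH hm)) (inv_mem D.ht)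
  · intro c
    obtain ⟨m, hm, hb⟩ := (D.mem_trans (i c)).mp ((hi _).mpr ⟨c, rfl⟩)
    refine ⟨m.1.1, m.1.2, ?_⟩
    ext z
    rw [hφ, mob_apply]
    induction z using OnePoint.rec with
    | infty =>
      rw [gl2_smul_infty, if_pos rfl, D.symm_infty]
      have : m.1.1 x = x := m.2
      rw [this, D.htx]
    | coe z =>
      rw [D.hab, gl2_smul_coe, hm, hb]
      simp
  · rintro _ ⟨m, hm, rfl⟩ z
    have hz : D.t.symm (OnePoint.map i z) ∈ MulAction.orbit H x := by
      rw [← hT]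
      induction z using OnePoint.rec with
      | infty => left; exact D.symm_infty
      | coe z => right; exact ⟨i z, (hi _).mpr ⟨z, rfl⟩, rfl⟩
    have hz2 : (⟨m, hm⟩ : H) • D.t.symm (OnePoint.map i z) ∈ MulAction.orbit H x := by
      obtain ⟨v, hv⟩ := hz
      rw [← hv]
      exact ⟨⟨m, hm⟩ * v, mul_smul _ _ _⟩
    rw [← hT] at hz2
    have e1 : φ m (OnePoint.map i z) = D.t ((⟨m, hm⟩ : H) • D.t.symm (OnePoint.map i z)) := rfl
    rcases hz2 with h | ⟨c, hc, h⟩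
    · refine ⟨OnePoint.infty, ?_⟩
      rw [e1, h, D.htx]; rfl
    · obtain ⟨v, rfl⟩ := (hi c).mp hc
      refine ⟨(v : OnePoint _), ?_⟩
      rw [e1, ← h]
      exact Equiv.apply_symm_apply _ _
  · obtain ⟨v, hv⟩ := hyO
    refine ⟨φ v, ⟨v.1, v.2, rfl⟩, ?_⟩
    rw [hφ, D.symm_infty]
    have : v.1 x = y := hv
    rw [this, ty]

theorem pgl2_iso {k : Type*} [Field k] [DecidableEq k]
    (H : Subgroup (GL (Fin 2) k ⧸ Subgroup.center (GL (Fin 2) k))) :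
    ∃ H' : Subgroup (Equiv.Perm (OnePoint k)), H' ≤ (mob k).range ∧ Nonempty (H ≃* H') := by
  let e1 := (QuotientGroup.quotientMulEquivOfEq (mob_ker (F := k))).symm
  let φ := (QuotientGroup.kerLift (mob k)).comp e1.toMonoidHom
  have hφ : Function.Injective φ := (QuotientGroup.kerLift_injective (mob k)).comp e1.injective
  refine ⟨H.map φ, ?_, ⟨H.equivMapOfInjective φ hφ⟩⟩
  rintro _ ⟨m, -, rfl⟩
  change QuotientGroup.kerLift (mob k) (e1 m) ∈ _
  obtain ⟨g, hg⟩ := QuotientGroup.mk_surjective (e1 m)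
  rw [← hg]
  exact ⟨g, rfl⟩

/-- Dickson's classification: every finite subgroup of `PGL₂(k)`, `k` algebraically closed
of characteristic `p > 0`, is cyclic, dihedral `D_{2m}`, `A₄`, `A₅`, `S₄`, an extension of a
cyclic group of prime-to-`p` order by an elementary abelian `p`-group (encoded via a
surjection onto a cyclic group `ℤ/q` with `q` coprime to `p` whose kernel is elementary
abelian), `PSL₂(𝔽_{p^r})`, or `PGL₂(𝔽_{p^r})`. -/
theorem finite_subgroup_pgl2_classification (k : Type*) [Field k] [IsAlgClosed k]
    (p : ℕ) [Fact p.Prime] [CharP k p] (H : Subgroup (PGL2 k)) (hfin : Finite H) :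
    IsCyclic H ∨
    (∃ m : ℕ, 0 < m ∧ Nonempty (H ≃* DihedralGroup m)) ∨
    Nonempty (H ≃* alternatingGroup (Fin 4)) ∨
    Nonempty (H ≃* alternatingGroup (Fin 5)) ∨
    Nonempty (H ≃* Equiv.Perm (Fin 4)) ∨
    (∃ (A : Subgroup H) (q : ℕ), A.Normal ∧ (∀ x y : A, x * y = y * x) ∧
      (∀ a : A, a ^ p = 1) ∧ 0 < q ∧ Nat.Coprime q p ∧
      ∃ φ : H →* Multiplicative (ZMod q), Function.Surjective φ ∧ φ.ker = A) ∨
    (∃ r : ℕ, 0 < r ∧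
      Nonempty (H ≃* Matrix.ProjectiveSpecialLinearGroup (Fin 2) (GaloisField p r))) ∨
    (∃ r : ℕ, 0 < r ∧
      Nonempty (H ≃* (GL (Fin 2) (GaloisField p r) ⧸
        Subgroup.center (GL (Fin 2) (GaloisField p r))))) := by
  classical
  obtain ⟨H', hH', ⟨e⟩⟩ := pgl2_iso H
  have : Finite H' := Finite.of_equiv _ e.toEquiv
  refine Concl.congr (p := p) e (classify_of_wild p hH' ?_)
  intro x q f h1 h2 h3 h4 h5
  exact concl_of_wild p hH' x q f h1 h2 h3 h4 h5
end
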